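/- arXiv:2306.04211 — 2 statements merged into one kernel-verified Lean document; each statement's English description precedes it below -/
import Mathlib

section
/- Let m ≥ 2 and let t be a symmetric traceless rank-2 tensor field on ℝ^m that is smooth on a neighborhood of the closed unit ball B̄. Then there exist a function u, a vector field w, and a rank-2 tensor field T, all smooth on B̄ (up to the boundary), such that for all x ∈ B̄ and all indices i,j one has t_ij = ◇_ij u + ½(∂_i w_j + ∂_j w_i) + T_ij, where: (i) u(x) = 0 for all x ∈ S; (ii) div w = 0 on B̄; (iii) ∑_k w_k(x) x_k = 0 for all x ∈ S; (iv) ∑_{k,l} (∂_k w_l − ∂_l w_k)(x) x_k v_l = 0 for every x ∈ S and every v ∈ ℝ^m with ⟨v,x⟩ = 0; (v) T is symmetric, ∑_i T_ii = 0 on B̄, and ∑_i ∂_i T_ij = 0 on B̄ for every j. (This is the paper's scalar–vector–tensor decomposition theorem for symmetric rank-2 tensors, Theorem 3.1, specialized to the flat ball, which is Ricci flat and has trivial cohomology.) -/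
/-!
STATEMENT 0: Scalar–vector–tensor decomposition of a symmetric traceless rank-2
tensor field on the closed unit ball in ℝ^m (paper's Theorem 3.1 specialized to
the flat ball).
-/

noncomputable section

/-- Euclidean space ℝ^m. -/
abbrev E (m : ℕ) := EuclideanSpace ℝ (Fin m)

/-- The closed unit ball B̄ ⊆ ℝ^m. -/
def Ball (m : ℕ) : Set (E m) := Metric.closedBall 0 1

/-- The unit sphere S = ∂B̄ ⊆ ℝ^m. -/
def Sph (m : ℕ) : Set (E m) := Metric.sphere 0 1

/-- The i-th partial derivative (taken within the closed unit ball, so that it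
is meaningful up to the boundary). -/
def pd {m : ℕ} (i : Fin m) (f : E m → ℝ) : E m → ℝ :=
  fun x => fderivWithin ℝ f (Ball m) x (EuclideanSpace.single i 1)

/-- The Euclidean Laplacian Δf = ∑ i, ∂_i ∂_i f. -/
def lap {m : ℕ} (f : E m → ℝ) : E m → ℝ :=
  fun x => ∑ i, pd i (pd i f) x

/-- The traceless Hessian operator ◇_ij u = ∂_i ∂_j u − (δ_ij/m) Δu. -/
def diam {m : ℕ} (i j : Fin m) (f : E m → ℝ) : E m → ℝ :=
  fun x => pd i (pd j f) x - (if i = j then (1 : ℝ) else 0) / m * lap f x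

namespace SVT

open MvPolynomial Filter Topology

/-- Real polynomials in `m` variables. -/
abbrev Pl (m : ℕ) := MvPolynomial (Fin m) ℝ

/-- Euler operator. -/
def D {m : ℕ} : Derivation ℝ (Pl m) (Pl m) := mkDerivation ℝ (fun i => X i)

/-- Rotation generators. -/
def L {m : ℕ} (i j : Fin m) : Derivation ℝ (Pl m) (Pl m) :=
  (X i : Pl m) • pderiv j - (X j : Pl m) • pderiv i

/-- Laplacian on polynomials. -/
def lapP {m : ℕ} : Pl m →ₗ[ℝ] Pl m :=
  ∑ i, (pderiv i).toLinearMap ∘ₗ (pderiv i).toLinearMap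

/-- `1 - r^2`. -/
def bd (m : ℕ) : Pl m := 1 - ∑ i, X i * X i

section algebra
variable {m : ℕ}

lemma der_sum {ι : Type} (s : Finset ι) (f : ι → Derivation ℝ (Pl m) (Pl m)) (P : Pl m) :
    (∑ i ∈ s, f i) P = ∑ i ∈ s, f i P := by
  classical
  induction s using Finset.induction_on with
  | empty => simp
  | insert a s ha ih => rw [Finset.sum_insert ha, Finset.sum_insert ha, Derivation.add_apply, ih]

lemma D_apply (P : Pl m) : D P = ∑ i, X i * pderiv i P := by
  have : (D : Derivation ℝ (Pl m) (Pl m)) = ∑ i, (X i : Pl m) • pderiv i := by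
    apply derivation_ext
    intro j
    rw [der_sum]
    simp [D, mkDerivation_X, pderiv_X, Pi.single_apply]
  rw [this, der_sum]
  simp

lemma L_apply (i j : Fin m) (P : Pl m) : L i j P = X i * pderiv j P - X j * pderiv i P := by
  simp [L]

lemma lapP_apply (P : Pl m) : lapP P = ∑ i, pderiv i (pderiv i P) := by
  simp [lapP]

@[simp] lemma D_X (i : Fin m) : D (X i : Pl m) = X i := by simp [D, mkDerivation_X]

lemma pd_comm (i j : Fin m) (P : Pl m) : pderiv i (pderiv j P) = pderiv j (pderiv i P) := by
  have h : ⁅(pderiv i : Derivation ℝ (Pl m) (Pl m)), (pderiv j : Derivation ℝ (Pl m) (Pl m))⁆ = 0 := by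
    apply derivation_ext
    intro k
    simp only [Derivation.commutator_apply, pderiv_X, Pi.single_apply]
    split_ifs <;> simp
  have := congrArg (fun d => d P) h
  simpa [Derivation.commutator_apply, sub_eq_zero] using this

lemma pd_D (i : Fin m) (P : Pl m) : pderiv i (D P) = D (pderiv i P) + pderiv i P := by
  have h : ⁅(pderiv i : Derivation ℝ (Pl m) (Pl m)), (D : Derivation ℝ (Pl m) (Pl m))⁆ = pderiv i := by
    apply derivation_ext
    intro k
    simp only [Derivation.commutator_apply, pderiv_X, Pi.single_apply, D_X]
    split_ifs <;> simp
  have := congrArg (fun d => d P) h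
  simp only [Derivation.commutator_apply] at this
  linear_combination this

lemma D_L (i j : Fin m) (P : Pl m) : L i j (D P) = D (L i j P) := by
  have h : ⁅(L i j : Derivation ℝ (Pl m) (Pl m)), (D : Derivation ℝ (Pl m) (Pl m))⁆ = 0 := by
    apply derivation_ext
    intro k
    simp only [Derivation.commutator_apply, pderiv_X, Pi.single_apply, D_X, L_apply]
    split_ifs <;> simp
  have := congrArg (fun d => d P) h
  simpa [Derivation.commutator_apply, sub_eq_zero] using this

lemma lap_pd (i : Fin m) (P : Pl m) : lapP (pderiv i P) = pderiv i (lapP P) := by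
  simp only [lapP_apply, map_sum]
  refine Finset.sum_congr rfl fun k _ => ?_
  rw [pd_comm k i, pd_comm k i]

lemma lap_D (P : Pl m) : lapP (D P) = D (lapP P) + 2 * lapP P := by
  simp only [lapP_apply, map_sum, Finset.mul_sum, ← Finset.sum_add_distrib, pd_D, map_add]
  refine Finset.sum_congr rfl fun k _ => ?_
  ring

lemma lap_X_mul (i : Fin m) (P : Pl m) :
    lapP (X i * P) = X i * lapP P + 2 * pderiv i P := by
  have : ∀ k : Fin m, pderiv k (pderiv k (X i * P)) =
      X i * pderiv k (pderiv k P) + if k = i then 2 * pderiv i P else 0 := by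
    intro k
    by_cases h : k = i
    · subst h; simp [pderiv_mul]; ring
    · have h' : i ≠ k := fun h' => h h'.symm
      simp [pderiv_mul, pderiv_X_of_ne h', h]
  simp only [lapP_apply, this, Finset.sum_add_distrib, Finset.mul_sum]
  simp

lemma lap_L (i j : Fin m) (P : Pl m) : lapP (L i j P) = L i j (lapP P) := by
  simp only [L_apply, map_sub, lap_X_mul, lap_pd]
  rw [pd_comm i j]; ring

lemma D_mul (P Q : Pl m) : D (P * Q) = P * D Q + Q * D P := by
  simp [Derivation.leibniz]

lemma L_mul (i j : Fin m) (P Q : Pl m) : L i j (P * Q) = P * L i j Q + Q * L i j P := by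
  simp [Derivation.leibniz]

lemma D_rsq : D (∑ i, X i * X i : Pl m) = 2 * ∑ i, X i * X i := by
  simp only [map_sum, D_mul, D_X, Finset.mul_sum]
  exact Finset.sum_congr rfl fun k _ => by ring

lemma L_X (i j k : Fin m) : L i j (X k : Pl m) =
    (if k = j then X i else 0) - (if k = i then X j else 0) := by
  simp only [L_apply, pderiv_X, Pi.single_apply, mul_ite, mul_one, mul_zero]

lemma L_rsq (i j : Fin m) : L i j (∑ i, X i * X i : Pl m) = 0 := by
  simp only [map_sum, L_mul, L_X, mul_sub, mul_ite, mul_zero, Finset.sum_add_distrib,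
    Finset.sum_sub_distrib]
  simp; ring

lemma pd_rsq (i : Fin m) : pderiv i (∑ i, X i * X i : Pl m) = 2 * X i := by
  simp only [map_sum, pderiv_mul, pderiv_X, Pi.single_apply]
  simp [Finset.sum_add_distrib]
  ring

lemma pd_bd (i : Fin m) : pderiv i (bd m) = - (2 * X i) := by
  rw [bd, map_sub, pd_rsq]; simp

lemma L_bd (i j : Fin m) : L i j (bd m) = 0 := by
  rw [bd, map_sub, L_rsq]; simp

@[simp] lemma pd_two (i : Fin m) : pderiv i (2 : Pl m) = 0 := by
  have : (2 : Pl m) = C 2 := (map_ofNat C 2).symm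
  rw [this, pderiv_C]

lemma lap_rsq : lapP (∑ i, X i * X i : Pl m) = 2 * (m : Pl m) := by
  simp only [lapP_apply, pd_rsq]
  simp; ring

lemma lap_bd_mul (Q : Pl m) :
    lapP (bd m * Q) = bd m * lapP Q - 4 * D Q - 2 * (m : Pl m) * Q := by
  simp only [lapP_apply, pderiv_mul, pd_bd, map_add, D_apply, Finset.mul_sum]
  simp [Finset.sum_add_distrib, ← Finset.mul_sum, ← Finset.sum_mul, mul_assoc]
  ring

lemma rsq_lap (P : Pl m) : 2 * ((∑ i, X i * X i) * lapP P) =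
    2 * D (D P) + 2 * ((m : Pl m) - 2) * D P + ∑ i, ∑ j, L i j (L i j P) := by
  have hDD : D (D P) = ∑ i, ∑ j, X i * X j * pderiv i (pderiv j P) + D P := by
    conv_lhs => rw [D_apply P]
    rw [map_sum]
    simp only [D_mul, D_X]
    rw [Finset.sum_add_distrib, Finset.sum_comm]
    congr 1
    · refine Finset.sum_congr rfl fun i _ => ?_
      rw [D_apply, Finset.mul_sum]
      refine Finset.sum_congr rfl fun j _ => ?_
      rw [pd_comm]; ring
    · rw [D_apply]; exact Finset.sum_congr rfl fun i _ => by ring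
  have hL : ∀ i j : Fin m, L i j (L i j P) =
      (X i * X i * pderiv j (pderiv j P) + X j * X j * pderiv i (pderiv i P)
        - 2 * (X i * X j * pderiv i (pderiv j P)))
      + ((if i = j then X i * pderiv i P + X j * pderiv j P else 0)
       - X i * pderiv i P - X j * pderiv j P) := by
    intro i j
    by_cases h : i = j
    · subst h
      simp [L_apply]; ring
    · have h' : j ≠ i := fun h' => h h'.symm
      simp only [L_apply, map_sub, pderiv_mul, pderiv_X_of_ne h, pderiv_X_of_ne h', pderiv_X_self,
        if_neg h]
      rw [pd_comm j i]; ring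
  simp only [hL, Finset.sum_add_distrib, Finset.sum_sub_distrib, hDD]
  simp only [D_apply, lapP_apply, Finset.sum_mul, Finset.mul_sum, Finset.sum_ite_eq,
    Finset.mem_univ, if_true, Finset.sum_add_distrib, Finset.sum_const, Finset.card_univ,
    Fintype.card_fin, nsmul_eq_mul]
  rw [Finset.sum_comm (f := fun i j : Fin m => X j * X j * pderiv i (pderiv i P))]
  simp only [← Finset.mul_sum, ← Finset.sum_mul]
  ring

lemma rsq_pd (i : Fin m) (P : Pl m) :
    (∑ i, X i * X i) * pderiv i P = X i * D P + ∑ j, X j * L j i P := by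
  simp only [L_apply, D_apply, Finset.mul_sum, ← Finset.sum_add_distrib, Finset.sum_mul]
  exact Finset.sum_congr rfl fun k _ => by ring

/-! The operator `J c`, inverse of `D + c`. -/

/-- Scale the monomial `α` by `1 / (|α| + c)`. -/
def J (c : ℝ) : Pl m →ₗ[ℝ] Pl m :=
  (basisMonomials (Fin m) ℝ).constr ℝ (fun α => monomial α (1 / ((α.degree : ℝ) + c)))

lemma J_monomial (c : ℝ) (α : Fin m →₀ ℕ) (a : ℝ) :
    J c (monomial α a) = monomial α (a / ((α.degree : ℝ) + c)) := by
  have h : (monomial α a : Pl m) = a • basisMonomials (Fin m) ℝ α := by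
    simp [smul_monomial]
  rw [h, map_smul, J, Module.Basis.constr_basis, smul_monomial]
  simp [div_eq_mul_inv]

lemma D_monomial (α : Fin m →₀ ℕ) (a : ℝ) :
    D (monomial α a : Pl m) = monomial α ((α.degree : ℝ) * a) := by
  have h := (isHomogeneous_monomial (R := ℝ) a (rfl : α.degree = α.degree)).sum_X_mul_pderiv
  rw [D_apply, h, ← map_nsmul, nsmul_eq_mul]

lemma D_J {c : ℝ} (hc : 0 < c) (P : Pl m) : D (J c P) + C c * J c P = P := by
  induction P using MvPolynomial.induction_on' with
  | monomial α a =>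
    rw [J_monomial, D_monomial, C_mul_monomial, ← map_add]
    congr 1
    have : (α.degree : ℝ) + c ≠ 0 := by positivity
    field_simp
  | add p q hp hq =>
    rw [map_add, map_add, mul_add]
    linear_combination hp + hq

lemma J_D {c : ℝ} (hc : 0 < c) (P : Pl m) : J c (D P + C c * P) = P := by
  induction P using MvPolynomial.induction_on' with
  | monomial α a =>
    rw [D_monomial, C_mul_monomial, ← map_add, J_monomial]
    congr 1
    have : (α.degree : ℝ) + c ≠ 0 := by positivity
    field_simp
  | add p q hp hq =>
    have : D (p + q) + C c * (p + q) = (D p + C c * p) + (D q + C c * q) := by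
      rw [map_add]; ring
    rw [this, map_add, hp, hq]

lemma D_J0 (P : Pl m) : D (J 0 P) = P - C (constantCoeff P) := by
  induction P using MvPolynomial.induction_on' with
  | monomial α a =>
    rw [J_monomial, D_monomial]
    by_cases h : α = 0
    · subst h; simp
    · have h1 : (α.degree : ℝ) ≠ 0 := by
        simpa [Finsupp.degree_eq_zero_iff] using h
      have : constantCoeff (monomial α a : Pl m) = 0 := by
        rw [constantCoeff_eq, coeff_monomial, if_neg h]
      rw [this]; simp; congr 1; field_simp
  | add p q hp hq =>
    simp only [map_add, hp, hq]; ring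

lemma J0_D (P : Pl m) : J 0 (D P) = P - C (constantCoeff P) := by
  induction P using MvPolynomial.induction_on' with
  | monomial α a =>
    rw [D_monomial, J_monomial]
    by_cases h : α = 0
    · subst h; simp
    · have h1 : (α.degree : ℝ) ≠ 0 := by
        simpa [Finsupp.degree_eq_zero_iff] using h
      have : constantCoeff (monomial α a : Pl m) = 0 := by
        rw [constantCoeff_eq, coeff_monomial, if_neg h]
      rw [this]; simp; congr 1; field_simp
  | add p q hp hq =>
    simp only [map_add, hp, hq]; ring

/-- Injectivity of `D + c`. -/
lemma D_inj {c : ℝ} (hc : 0 < c) {P Q : Pl m} (h : D P + C c * P = D Q + C c * Q) : P = Q := by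
  rw [← J_D hc P, h, J_D hc Q]

/-- `D + c` is injective on polynomials without constant term, for `c ≥ 0`. -/
lemma D_inj' {c : ℝ} (hc : 0 ≤ c) {P : Pl m} (h0 : constantCoeff P = 0)
    (h : D P + C c * P = 0) : P = 0 := by
  rcases hc.eq_or_lt with rfl | hc
  · have := J0_D P
    simp only [map_zero, zero_mul, add_zero] at h
    rw [h, h0] at this
    simpa using this.symm
  · exact D_inj hc (by simpa using h)

lemma D_J' {c : ℝ} (hc : 0 ≤ c) {P : Pl m} (h0 : constantCoeff P = 0) :
    D (J c P) + C c * J c P = P := by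
  rcases hc.eq_or_lt with rfl | hc
  · rw [D_J0, h0]; simp
  · exact D_J hc P

lemma pd_J {c : ℝ} (hc : 0 ≤ c) (i : Fin m) (P : Pl m) :
    pderiv i (J c P) = J (c + 1) (pderiv i P) := by
  have h1 : pderiv i (D (J c P) + C c * J c P) = pderiv i P := by
    rcases hc.eq_or_lt with rfl | hc
    · rw [D_J0]; simp
    · rw [D_J hc]
  rw [map_add, pd_D, pderiv_C_mul] at h1
  apply D_inj (c := c + 1) (by positivity)
  rw [D_J (by positivity), ← h1, map_add, map_one]; ring

lemma cc_L (i j : Fin m) (P : Pl m) : constantCoeff (L i j P) = 0 := by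
  simp [L_apply]

end algebra

end SVT

namespace SVT

open MvPolynomial Filter Topology

section maxprinciple
variable {m : ℕ}

/-- Evaluation of polynomials at points of Euclidean space. -/
def ev (x : E m) : Pl m →+* ℝ := eval x.ofLp

@[simp] lemma ev_X (x : E m) (i : Fin m) : ev x (X i) = x i := by simp [ev]
@[simp] lemma ev_C (x : E m) (a : ℝ) : ev x (C a) = a := by simp [ev]
lemma ev_zero (P : Pl m) : ev 0 P = constantCoeff P := by
  simp [ev, constantCoeff_eq, eval_zero']

lemma ev_smul (x : E m) (a : ℝ) (P : Pl m) : ev x (a • P) = a * ev x P := by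
  simp [ev]

lemma norm_sq' (x : E m) : ‖x‖ ^ 2 = ∑ i, x i * x i := by
  rw [EuclideanSpace.real_norm_sq_eq]
  exact Finset.sum_congr rfl fun i _ => by ring

lemma ev_rsq (x : E m) : ev x (∑ i, X i * X i) = ‖x‖ ^ 2 := by
  rw [norm_sq']; simp

lemma ev_bd (x : E m) : ev x (bd m) = 1 - ‖x‖ ^ 2 := by
  rw [bd, map_sub, ev_rsq, map_one]

lemma mem_Ball {x : E m} : x ∈ Ball m ↔ ‖x‖ ≤ 1 := by simp [Ball]
lemma mem_Sph {x : E m} : x ∈ Sph m ↔ ‖x‖ = 1 := by simp [Sph]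
lemma Sph_sub {x : E m} (h : x ∈ Sph m) : x ∈ Ball m := by
  rw [mem_Ball, mem_Sph.1 h]

lemma ev_bd_Sph {x : E m} (h : x ∈ Sph m) : ev x (bd m) = 0 := by
  rw [ev_bd, mem_Sph.1 h]; norm_num

lemma ev_rsq_Sph {x : E m} (h : x ∈ Sph m) : ev x (∑ i, X i * X i) = 1 := by
  rw [ev_rsq, mem_Sph.1 h]; norm_num

/-- Derivative of a polynomial function. -/
def dev (P : Pl m) (x : E m) : E m →L[ℝ] ℝ :=
  ∑ i, ev x (pderiv i P) • (EuclideanSpace.proj i : E m →L[ℝ] ℝ)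

lemma dev_apply (P : Pl m) (x v : E m) : dev P x v = ∑ i, ev x (pderiv i P) * v i := by
  simp [dev]

lemma hasFDerivAt_ev (P : Pl m) (x : E m) :
    HasFDerivAt (fun y => ev y P) (dev P x) x := by
  induction P using MvPolynomial.induction_on with
  | C a =>
    have : dev (C a : Pl m) x = 0 := by ext v; simp [dev_apply]
    rw [this]; simp only [ev_C]; exact hasFDerivAt_const _ _
  | add p q hp hq =>
    have : dev (p + q) x = dev p x + dev q x := by
      ext v; simp [dev_apply, add_mul, Finset.sum_add_distrib]
    rw [this]; simp only [map_add]; exact hp.add hq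
  | mul_X p i hp =>
    have : dev (p * X i) x = ev x p • (EuclideanSpace.proj i : E m →L[ℝ] ℝ) + x i • dev p x := by
      ext v
      simp only [dev_apply, pderiv_mul, pderiv_X, Pi.single_apply, map_add, map_mul, ev_X, add_mul,
        Finset.sum_add_distrib, ContinuousLinearMap.add_apply, ContinuousLinearMap.smul_apply,
        PiLp.proj_apply, smul_eq_mul, Finset.mul_sum]
      rw [add_comm]
      congr 1
      · rw [Finset.sum_eq_single i]
        · simp
        · intro b _ hb; simp [hb.symm]
        · simp
      · exact Finset.sum_congr rfl fun k _ => by ring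
    rw [this]; simp only [map_mul, ev_X]
    exact hp.mul (EuclideanSpace.proj i : E m →L[ℝ] ℝ).hasFDerivAt

lemma continuous_ev (P : Pl m) : Continuous (fun y => ev y P) :=
  continuous_iff_continuousAt.2 fun x => (hasFDerivAt_ev P x).continuousAt

lemma hasDerivAt_line (P : Pl m) (x v : E m) (s : ℝ) :
    HasDerivAt (fun s : ℝ => ev (x + s • v) P) (∑ i, ev (x + s • v) (pderiv i P) * v i) s := by
  rw [← dev_apply]
  have h : HasDerivAt (fun s : ℝ => x + s • v) v s := by
    simpa using ((hasDerivAt_id s).smul_const v).const_add x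
  exact (hasFDerivAt_ev P (x + s • v)).comp_hasDerivAt s h

lemma hasDerivAt_coord (P : Pl m) (x : E m) (i : Fin m) (s : ℝ) :
    HasDerivAt (fun s : ℝ => ev (x + s • EuclideanSpace.single i 1) P)
      (ev (x + s • EuclideanSpace.single i 1) (pderiv i P)) s := by
  have := hasDerivAt_line P x (EuclideanSpace.single i 1) s
  simpa [Pi.single_apply] using this

lemma second_deriv_nonpos {φ : ℝ → ℝ} (hc : ContinuousAt φ 0) (h : IsLocalMax φ 0) :
    deriv (deriv φ) 0 ≤ 0 := by
  by_contra! hpos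
  have h1 := isLocalMin_of_deriv_deriv_pos hpos h.deriv_eq_zero hc
  have h2 : φ =ᶠ[𝓝 0] fun _ => φ 0 := by
    filter_upwards [h, h1] with y hy hy'
    exact le_antisymm hy hy'
  have h3 := h2.deriv.deriv_eq
  simp at h3
  linarith

lemma isCompact_Ball : IsCompact (Ball m) := isCompact_closedBall 0 1

lemma mp_strict {v : Pl m} (h : ∀ x ∈ Ball m, 0 < ev x (lapP v))
    (hS : ∀ x ∈ Sph m, ev x v ≤ 0) : ∀ x ∈ Ball m, ev x v ≤ 0 := by
  obtain ⟨x0, hx0, hmax⟩ := (isCompact_Ball (m := m)).exists_isMaxOn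
    ⟨0, by simp [mem_Ball]⟩ (continuous_ev v).continuousOn
  by_cases hp : ev x0 v ≤ 0
  · exact fun x hx => (hmax hx).trans hp
  exfalso
  have hlt : ‖x0‖ < 1 := by
    refine lt_of_le_of_ne (mem_Ball.1 hx0) fun heq => hp (hS x0 (mem_Sph.2 heq))
  have key : ∀ i, ev x0 (pderiv i (pderiv i v)) ≤ 0 := by
    intro i
    set φ : ℝ → ℝ := fun s => ev (x0 + s • EuclideanSpace.single i 1) v with hφ
    have hd : deriv φ = fun s => ev (x0 + s • EuclideanSpace.single i 1) (pderiv i v) :=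
      funext fun s => (hasDerivAt_coord v x0 i s).deriv
    have hloc : IsLocalMax φ 0 := by
      have hcont : ContinuousAt (fun s : ℝ => ‖x0 + s • (EuclideanSpace.single i 1 : E m)‖) 0 := by
        fun_prop
      have : ∀ᶠ s : ℝ in 𝓝 0, ‖x0 + s • (EuclideanSpace.single i 1 : E m)‖ < 1 :=
        hcont.eventually_lt continuousAt_const (by simpa using hlt)
      filter_upwards [this] with s hs
      simpa [hφ] using hmax (mem_Ball.2 hs.le)
    have := second_deriv_nonpos (hasDerivAt_coord v x0 i 0).continuousAt hloc
    rw [hd, (hasDerivAt_coord (pderiv i v) x0 i 0).deriv] at this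
    simpa using this
  have := h x0 hx0
  rw [lapP_apply, map_sum] at this
  exact absurd this (not_lt.2 (Finset.sum_nonpos fun i _ => key i))

lemma lap_bd' : lapP (bd m) = - (2 * (m : Pl m)) := by
  have := lap_bd_mul (m := m) 1
  simpa [lapP_apply] using this

lemma lap_C_mul (a : ℝ) (P : Pl m) : lapP (C a * P) = C a * lapP P := by
  rw [← smul_eq_C_mul, map_smul, smul_eq_C_mul]

lemma bd_bounds {x : E m} (hx : x ∈ Ball m) : 0 ≤ ev x (bd m) ∧ ev x (bd m) ≤ 1 := by
  rw [ev_bd]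
  have := mem_Ball.1 hx
  constructor <;> nlinarith [norm_nonneg x]

lemma mp (hm : 2 ≤ m) {v : Pl m} (h : ∀ x ∈ Ball m, 0 ≤ ev x (lapP v))
    (hS : ∀ x ∈ Sph m, ev x v ≤ 0) : ∀ x ∈ Ball m, ev x v ≤ 0 := by
  have hm' : (2 : ℝ) ≤ m := by exact_mod_cast hm
  intro x hx
  refine le_of_forall_pos_le_add fun ε hε => ?_
  have := mp_strict (v := v - C ε * bd m) ?_ ?_ x hx
  · have hb := bd_bounds hx
    simp only [map_sub, map_mul, ev_C] at this
    nlinarith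
  · intro y hy
    have := h y hy
    simp only [map_sub, lap_C_mul, lap_bd', map_mul, map_neg, map_natCast, map_ofNat, ev_C]
    nlinarith [mul_pos hε (by linarith : (0 : ℝ) < m)]
  · intro y hy
    simpa [ev_bd_Sph hy] using hS y hy

lemma mp_bound (hm : 2 ≤ m) {v : Pl m} {M b : ℝ} (h : ∀ x ∈ Ball m, |ev x (lapP v)| ≤ M)
    (hS : ∀ x ∈ Sph m, |ev x v| ≤ b) : ∀ x ∈ Ball m, |ev x v| ≤ b + M * ev x (bd m) := by
  have hm' : (2 : ℝ) ≤ m := by exact_mod_cast hm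
  intro x hx
  have hM : 0 ≤ M := (abs_nonneg _).trans (h x hx)
  have hlc : ∀ a : ℝ, lapP (C a : Pl m) = 0 := fun a => by simp [lapP_apply]
  rw [abs_le]
  constructor
  · have := mp hm (v := - v - C b - C M * bd m) ?_ ?_ x hx
    · simp only [map_sub, map_neg, map_mul, ev_C] at this
      linarith
    · intro y hy
      have := abs_le.1 (h y hy)
      simp only [map_sub, lap_C_mul, lap_bd', map_mul, map_neg, map_natCast, map_ofNat, ev_C, hlc,
        map_zero]
      nlinarith
    · intro y hy
      have := abs_le.1 (hS y hy)
      simp only [map_sub, map_neg, map_mul, ev_C, ev_bd_Sph hy]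
      linarith
  · have := mp hm (v := v - C b - C M * bd m) ?_ ?_ x hx
    · simp only [map_sub, map_mul, ev_C] at this
      linarith
    · intro y hy
      have := abs_le.1 (h y hy)
      simp only [map_sub, lap_C_mul, lap_bd', map_mul, map_neg, map_natCast, map_ofNat, ev_C, hlc,
        map_zero]
      nlinarith
    · intro y hy
      have := abs_le.1 (hS y hy)
      simp only [map_sub, map_mul, ev_C, ev_bd_Sph hy]
      linarith

/-- The barrier estimate. -/
lemma barrier (hm : 2 ≤ m) {Q : Pl m} {M : ℝ} (h : ∀ x ∈ Ball m, |ev x (lapP (bd m * Q))| ≤ M) :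
    ∀ x ∈ Ball m, |ev x Q| ≤ M := by
  have h1 : ∀ x ∈ Metric.ball (0 : E m) 1, |ev x Q| ≤ M := by
    intro x hx
    have hx' : ‖x‖ < 1 := by simpa using hx
    have h2 := mp_bound hm (b := 0) h (fun y hy => by simp [ev_bd_Sph hy]) x (mem_Ball.2 hx'.le)
    have h3 : 0 < ev x (bd m) := by rw [ev_bd]; nlinarith [norm_nonneg x]
    rw [map_mul, abs_mul, abs_of_pos h3, zero_add, mul_comm] at h2
    exact le_of_mul_le_mul_right h2 h3
  intro x hx
  have hcl : x ∈ closure (Metric.ball (0 : E m) 1) := by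
    rw [closure_ball _ one_ne_zero]; exact hx
  exact le_on_closure h1 ((continuous_ev Q).abs.continuousOn) continuousOn_const hcl

lemma eq_zero_of_Ball {Q : Pl m} (h : ∀ x ∈ Ball m, ev x Q = 0) : Q = 0 := by
  have hm0 : (0 : ℝ) < m + 1 := by positivity
  apply MvPolynomial.funext_set (fun _ => Set.Icc (0 : ℝ) (1 / (m + 1)))
    (fun _ => Set.Icc_infinite (by positivity))
  intro x hx
  have := h (WithLp.toLp 2 x) ?_
  · simpa [ev] using this
  rw [mem_Ball]
  have h2 : ‖(WithLp.toLp 2 x : E m)‖ ^ 2 ≤ 1 := by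
    rw [norm_sq']
    calc ∑ i, x i * x i ≤ ∑ i : Fin m, (1 / (m + 1) : ℝ) := by
          refine Finset.sum_le_sum fun i _ => ?_
          have h0 := (hx i (Set.mem_univ i)).1
          have h1 := (hx i (Set.mem_univ i)).2
          have h3 : (1 / (m + 1) : ℝ) ≤ 1 := by
            rw [div_le_one hm0]; linarith [(Nat.cast_nonneg m : (0 : ℝ) ≤ m)]
          nlinarith
      _ ≤ 1 := by
          simp only [Finset.sum_const, Finset.card_univ, Fintype.card_fin, nsmul_eq_mul]
          rw [mul_one_div, div_le_one hm0]; linarith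
  nlinarith [norm_nonneg (WithLp.toLp 2 x : E m)]

/-! The polynomial Dirichlet problem. -/

/-- `Q ↦ Δ((1 - r²) Q)`. -/
def opA : Pl m →ₗ[ℝ] Pl m := lapP ∘ₗ LinearMap.mulLeft ℝ (bd m)

lemma opA_apply (Q : Pl m) : opA Q = lapP (bd m * Q) := rfl

lemma opA_inj (hm : 2 ≤ m) : Function.Injective (opA (m := m)) := by
  rw [← LinearMap.ker_eq_bot, LinearMap.ker_eq_bot']
  intro Q hQ
  refine eq_zero_of_Ball fun x hx => ?_
  have := barrier hm (Q := Q) (M := 0) (fun y _ => by rw [← opA_apply, hQ]; simp) x hx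
  simpa using this

lemma pderiv_deg (i : Fin m) (P : Pl m) : (pderiv i P).totalDegree ≤ P.totalDegree - 1 := by
  rw [totalDegree, Finset.sup_le_iff]
  intro s hs
  rw [mem_support_iff, coeff_pderiv] at hs
  have h1 : coeff (s + Finsupp.single i 1) P ≠ 0 := fun h0 => hs (by rw [h0]; simp)
  have h2 := le_totalDegree (mem_support_iff.2 h1)
  change s.degree ≤ _
  change (s + Finsupp.single i 1).degree ≤ _ at h2
  rw [map_add, Finsupp.degree_single] at h2
  omega

lemma D_deg {n : ℕ} {Q : Pl m} (h : Q.totalDegree ≤ n) : (D Q).totalDegree ≤ n := by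
  rw [D_apply]
  refine (totalDegree_finsetSum _ _).trans (Finset.sup_le fun i _ => ?_)
  by_cases h0 : pderiv i Q = 0
  · simp [h0]
  have h1 := pderiv_deg i Q
  by_cases hz : Q.totalDegree = 0
  · have : Q = C (coeff 0 Q) := totalDegree_eq_zero_iff_eq_C.1 hz
    rw [this] at h0; simp at h0
  have h2 := totalDegree_mul (X i) (pderiv i Q)
  rw [totalDegree_X] at h2
  omega

lemma bd_deg : (bd m).totalDegree ≤ 2 := by
  rw [bd]
  refine (totalDegree_sub _ _).trans (max_le (by simp) ?_)
  refine (totalDegree_finsetSum _ _).trans (Finset.sup_le fun i _ => ?_)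
  refine (totalDegree_mul _ _).trans ?_
  simp [totalDegree_X]

lemma lap_deg {n : ℕ} {Q : Pl m} (h : Q.totalDegree ≤ n) : (bd m * lapP Q).totalDegree ≤ n := by
  rw [lapP_apply, Finset.mul_sum]
  refine (totalDegree_finsetSum _ _).trans (Finset.sup_le fun i _ => ?_)
  by_cases h0 : pderiv i (pderiv i Q) = 0
  · simp [h0]
  have hne : ∀ P : Pl m, pderiv i P ≠ 0 → 1 ≤ P.totalDegree := by
    intro P hP
    by_contra! hz
    have : P = C (coeff 0 P) := totalDegree_eq_zero_iff_eq_C.1 (by omega)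
    rw [this] at hP; simp at hP
  have h1 := pderiv_deg i Q
  have h2 := pderiv_deg i (pderiv i Q)
  have h3 := hne _ h0
  have h5 := totalDegree_mul (bd m) (pderiv i (pderiv i Q))
  have h6 := bd_deg (m := m)
  omega

lemma opA_deg {n : ℕ} {Q : Pl m} (h : Q.totalDegree ≤ n) : (opA Q).totalDegree ≤ n := by
  rw [opA_apply, lap_bd_mul]
  have e1 : (4 : Pl m) * D Q = C (4 : ℝ) * D Q := by rw [map_ofNat]
  have e2 : (2 : Pl m) * (m : Pl m) * Q = C (2 * m : ℝ) * Q := by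
    rw [map_mul, map_ofNat, map_natCast]
  rw [e1, e2]
  refine (totalDegree_sub _ _).trans (max_le ((totalDegree_sub _ _).trans (max_le ?_ ?_)) ?_)
  · exact lap_deg h
  · refine (totalDegree_mul _ _).trans ?_
    simpa using D_deg h
  · refine (totalDegree_mul _ _).trans ?_
    rw [totalDegree_C, zero_add]; exact h

lemma opA_surj (hm : 2 ≤ m) : Function.Surjective (opA (m := m)) := by
  intro F
  set n := F.totalDegree
  have hmap : ∀ Q ∈ restrictTotalDegree (Fin m) ℝ n, opA Q ∈ restrictTotalDegree (Fin m) ℝ n := by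
    intro Q hQ
    rw [mem_restrictTotalDegree] at hQ ⊢
    exact opA_deg hQ
  have hinj : Function.Injective (opA.restrict hmap) := by
    intro a b hab
    apply Subtype.ext
    apply opA_inj hm
    exact congrArg Subtype.val hab
  have hsurj := LinearMap.injective_iff_surjective.1 hinj
  obtain ⟨Q, hQ⟩ := hsurj ⟨F, (mem_restrictTotalDegree _ _ _).2 le_rfl⟩
  exact ⟨Q, congrArg Subtype.val hQ⟩

/-- The quotient of the Dirichlet solution by `1 - r²`. -/
def Dq (hm : 2 ≤ m) : Pl m →ₗ[ℝ] Pl m :=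
  (LinearEquiv.ofBijective opA ⟨opA_inj hm, opA_surj hm⟩).symm.toLinearMap

/-- The Dirichlet solution operator. -/
def Dir (hm : 2 ≤ m) : Pl m →ₗ[ℝ] Pl m := LinearMap.mulLeft ℝ (bd m) ∘ₗ Dq hm

lemma Dir_eq (hm : 2 ≤ m) (F : Pl m) : Dir hm F = bd m * Dq hm F := rfl

lemma lap_Dir (hm : 2 ≤ m) (F : Pl m) : lapP (Dir hm F) = F := by
  rw [Dir_eq, ← opA_apply]
  exact (LinearEquiv.ofBijective opA ⟨opA_inj hm, opA_surj hm⟩).apply_symm_apply F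

lemma Dir_unique (hm : 2 ≤ m) (Q : Pl m) : Dir hm (lapP (bd m * Q)) = bd m * Q := by
  rw [Dir_eq]; congr 1
  exact (LinearEquiv.ofBijective opA ⟨opA_inj hm, opA_surj hm⟩).symm_apply_apply Q

lemma bd_harm (hm : 2 ≤ m) {Q : Pl m} (h : lapP (bd m * Q) = 0) : Q = 0 :=
  opA_inj hm (by rw [opA_apply, h, map_zero])

lemma L_Dir (hm : 2 ≤ m) (i j : Fin m) (F : Pl m) : L i j (Dir hm F) = Dir hm (L i j F) := by
  have h1 : L i j (Dir hm F) = bd m * L i j (Dq hm F) := by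
    rw [Dir_eq, L_mul, L_bd]; ring
  rw [h1, ← Dir_unique hm, ← h1, lap_L, lap_Dir]

lemma ev_Dir_Sph (hm : 2 ≤ m) (F : Pl m) {x : E m} (hx : x ∈ Sph m) : ev x (Dir hm F) = 0 := by
  rw [Dir_eq, map_mul, ev_bd_Sph hx, zero_mul]

end maxprinciple

end SVT

namespace SVT

open MvPolynomial Filter Topology

section estimates
variable {m : ℕ} {ι : Type} {l : Filter ι}

/-- Uniform convergence to zero on `K` of a family of polynomials. -/
def UZ (l : Filter ι) (K : Set (E m)) (P : ι → Pl m) : Prop :=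
  ∀ ε > 0, ∀ᶠ n in l, ∀ x ∈ K, |ev x (P n)| ≤ ε

lemma UZ.add {K : Set (E m)} {P Q : ι → Pl m} (hP : UZ l K P) (hQ : UZ l K Q) :
    UZ l K (fun n => P n + Q n) := by
  intro ε hε
  filter_upwards [hP (ε / 2) (by positivity), hQ (ε / 2) (by positivity)] with n h1 h2 x hx
  rw [map_add]
  exact (abs_add_le _ _).trans (by linarith [h1 x hx, h2 x hx])

lemma UZ.zero {K : Set (E m)} : UZ l K (fun _ => 0) := by
  intro ε hε
  filter_upwards with n x _
  simpa using hε.le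

lemma UZ.sum {κ : Type} (s : Finset κ) {K : Set (E m)} {P : κ → ι → Pl m}
    (hP : ∀ k, UZ l K (P k)) : UZ l K (fun n => ∑ k ∈ s, P k n) := by
  classical
  induction s using Finset.induction_on with
  | empty => simpa using UZ.zero
  | insert a s ha ih => simp only [Finset.sum_insert ha]; exact (hP a).add ih

lemma ev_bounded (Q : Pl m) : ∃ B > 0, ∀ x ∈ Ball m, |ev x Q| ≤ B := by
  obtain ⟨B, hB⟩ := (isCompact_Ball (m := m)).exists_bound_of_continuousOn
    (continuous_ev Q).continuousOn
  exact ⟨max B 1, by positivity, fun x hx => (hB x hx).trans (le_max_left _ _)⟩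

lemma UZ.mul {K : Set (E m)} (hK : K ⊆ Ball m) (Q : Pl m) {P : ι → Pl m} (hP : UZ l K P) :
    UZ l K (fun n => Q * P n) := by
  intro ε hε
  obtain ⟨B, hB, hQ⟩ := ev_bounded Q
  filter_upwards [hP (ε / B) (by positivity)] with n h x hx
  rw [map_mul, abs_mul]
  calc _ ≤ B * (ε / B) :=
        mul_le_mul (hQ x (hK hx)) (h x hx) (abs_nonneg _) hB.le
    _ = ε := by field_simp

lemma UZ.congr {K : Set (E m)} {P Q : ι → Pl m} (h : ∀ n, ∀ x ∈ K, ev x (Q n) = ev x (P n))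
    (hP : UZ l K P) : UZ l K Q := by
  intro ε hε
  filter_upwards [hP ε hε] with n hn x hx
  rw [h n x hx]; exact hn x hx

/-- Iterated partial derivatives. -/
def dw : List (Fin m) → (Pl m →ₗ[ℝ] Pl m)
  | [] => LinearMap.id
  | i :: w => dw w ∘ₗ (pderiv i).toLinearMap

@[simp] lemma dw_nil (P : Pl m) : dw [] P = P := rfl
@[simp] lemma dw_cons (i : Fin m) (w : List (Fin m)) (P : Pl m) :
    dw (i :: w) P = dw w (pderiv i P) := rfl

/-- Convergence to zero in `C^∞` of the closed ball. -/
def Null (l : Filter ι) (P : ι → Pl m) : Prop :=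
  ∀ w : List (Fin m), UZ l (Ball m) (fun n => dw w (P n))

lemma Null.add {P Q : ι → Pl m} (hP : Null l P) (hQ : Null l Q) : Null l (fun n => P n + Q n) := by
  intro w
  simp only [map_add]
  exact (hP w).add (hQ w)

lemma Null.zero : Null l (fun _ => (0 : Pl m)) := by
  intro w
  simp only [map_zero]
  exact UZ.zero

lemma Null.sum {κ : Type} (s : Finset κ) {P : κ → ι → Pl m}
    (hP : ∀ k, Null l (P k)) : Null l (fun n => ∑ k ∈ s, P k n) := by
  intro w
  simp only [map_sum]
  exact UZ.sum s fun k => hP k w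

lemma Null.pd {P : ι → Pl m} (hP : Null l P) (i : Fin m) : Null l (fun n => pderiv i (P n)) :=
  fun w => hP (i :: w)

lemma Null.mul (Q : Pl m) {P : ι → Pl m} (hP : Null l P) : Null l (fun n => Q * P n) := by
  intro w
  induction w generalizing Q P with
  | nil => exact (hP []).mul subset_rfl Q
  | cons i w ih =>
    simp only [dw_cons, pderiv_mul, map_add]
    exact (ih _ hP).add (ih _ (hP.pd i))

lemma Null.neg {P : ι → Pl m} (hP : Null l P) : Null l (fun n => - P n) := by
  simpa using hP.mul (-1)

lemma Null.sub {P Q : ι → Pl m} (hP : Null l P) (hQ : Null l Q) : Null l (fun n => P n - Q n) := by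
  simpa [sub_eq_add_neg] using hP.add hQ.neg

/-! Boundary words. -/

/-- The derivations tangent to the Euler and rotation flows. -/
def dd : Option (Fin m × Fin m) → Derivation ℝ (Pl m) (Pl m)
  | none => D
  | some p => L p.1 p.2

/-- Words in these derivations. -/
def Wd : List (Option (Fin m × Fin m)) → (Pl m →ₗ[ℝ] Pl m)
  | [] => LinearMap.id
  | b :: w => Wd w ∘ₗ (dd b).toLinearMap

@[simp] lemma Wd_nil (P : Pl m) : Wd [] P = P := rfl
@[simp] lemma Wd_cons (b : Option (Fin m × Fin m)) (w : List (Option (Fin m × Fin m))) (P : Pl m) :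
    Wd (b :: w) P = Wd w (dd b P) := rfl

/-- All words in the Euler and rotation derivations tend to zero on the sphere. -/
def SN (l : Filter ι) (P : ι → Pl m) : Prop :=
  ∀ w, UZ l (Sph m) (fun n => Wd w (P n))

lemma SN.add {P Q : ι → Pl m} (hP : SN l P) (hQ : SN l Q) : SN l (fun n => P n + Q n) := by
  intro w
  simp only [map_add]
  exact (hP w).add (hQ w)

lemma SN.sum {κ : Type} (s : Finset κ) {P : κ → ι → Pl m}
    (hP : ∀ k, SN l (P k)) : SN l (fun n => ∑ k ∈ s, P k n) := by
  intro w
  simp only [map_sum]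
  exact UZ.sum s fun k => hP k w

lemma SN.dd {P : ι → Pl m} (hP : SN l P) (b : Option (Fin m × Fin m)) :
    SN l (fun n => dd b (P n)) := fun w => hP (b :: w)

lemma Sph_subset : Sph m ⊆ Ball m := fun _ h => Sph_sub h

lemma SN.mul (Q : Pl m) {P : ι → Pl m} (hP : SN l P) : SN l (fun n => Q * P n) := by
  intro w
  induction w generalizing Q P with
  | nil => exact (hP []).mul Sph_subset Q
  | cons b w ih =>
    simp only [Wd_cons, Derivation.leibniz, smul_eq_mul, map_add]
    refine (ih _ (hP.dd b)).add ?_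
    have := ih (SVT.dd b Q) hP
    simpa only [mul_comm] using this

lemma SN.neg {P : ι → Pl m} (hP : SN l P) : SN l (fun n => - P n) := by
  simpa using hP.mul (-1)

lemma SN.sub {P Q : ι → Pl m} (hP : SN l P) (hQ : SN l Q) : SN l (fun n => P n - Q n) := by
  simpa [sub_eq_add_neg] using hP.add hQ.neg

lemma SN.of_rsq {Q : ι → Pl m} (h : SN l (fun n => (∑ i, X i * X i) * Q n)) : SN l Q := by
  intro w
  induction w generalizing Q with
  | nil =>
    refine (h []).congr fun n x hx => ?_
    simp only [Wd_nil]
    rw [map_mul, ev_rsq_Sph hx, one_mul]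
  | cons b w ih =>
    simp only [Wd_cons]
    apply ih
    cases b with
    | none =>
      have h2 := (h.dd none).sub (h.mul 2)
      convert h2 using 2 with n
      change _ * D (Q n) = D (_ * Q n) - _
      rw [D_mul, D_rsq]; ring
    | some p =>
      have h2 := h.dd (some p)
      convert h2 using 2 with n
      change _ * L p.1 p.2 (Q n) = L p.1 p.2 (_ * Q n)
      rw [L_mul, L_rsq]; ring

lemma SN.pd {P : ι → Pl m} (hP : SN l P) (i : Fin m) : SN l (fun n => pderiv i (P n)) := by
  apply SN.of_rsq
  simp only [rsq_pd]
  exact ((hP.dd none).mul (X i)).add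
    (SN.sum _ fun j => ((hP.dd (some (j, i))).mul (X j)))

lemma SN.dw {P : ι → Pl m} (hP : SN l P) (w : List (Fin m)) : SN l (fun n => dw w (P n)) := by
  induction w generalizing P with
  | nil => exact hP
  | cons i w ih => exact ih (hP.pd i)

lemma Null.D {P : ι → Pl m} (hP : Null l P) : Null l (fun n => D (P n)) := by
  simp only [D_apply]
  exact Null.sum _ fun i => (hP.pd i).mul _

lemma Null.L {P : ι → Pl m} (hP : Null l P) (i j : Fin m) : Null l (fun n => L i j (P n)) := by
  simp only [L_apply]
  exact ((hP.pd j).mul _).sub ((hP.pd i).mul _)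

lemma Null.SN {P : ι → Pl m} (hP : Null l P) : SN l P := by
  intro w
  induction w generalizing P with
  | nil =>
    intro ε hε
    filter_upwards [hP [] ε hε] with n hn x hx
    exact hn x (Sph_sub hx)
  | cons b w ih =>
    cases b with
    | none => exact ih hP.D
    | some p => exact ih (hP.L p.1 p.2)

lemma D_bd : D (bd m) = - (2 * ∑ i, X i * X i) := by
  rw [bd, map_sub, D_rsq]; simp

lemma Dir_SN_aux (hm : 2 ≤ m) (w : List (Option (Fin m × Fin m))) :
    (∀ F : ι → Pl m, Null l F → UZ l (Sph m) (fun n => Wd w (Dir hm (F n)))) ∧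
    (∀ F : ι → Pl m, Null l F → UZ l (Sph m) (fun n => Wd w (D (Dir hm (F n))))) := by
  induction w with
  | nil =>
    constructor
    · intro F _
      refine UZ.congr (P := fun _ => 0) (fun n x hx => ?_) UZ.zero
      simp [ev_Dir_Sph hm _ hx]
    · intro F hF ε hε
      filter_upwards [hF [] (ε / 2) (by positivity)] with n hn x hx
      have h1 := barrier hm (Q := Dq hm (F n)) (M := ε / 2)
        (fun y hy => by rw [← Dir_eq, lap_Dir]; exact hn y hy) x (Sph_sub hx)
      simp only [Wd_nil, Dir_eq, D_mul, D_bd]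
      rw [map_add, map_mul, ev_bd_Sph hx, zero_mul, zero_add, map_mul, map_neg, map_mul,
        ev_rsq_Sph hx, abs_mul, map_ofNat]
      norm_num
      linarith
  | cons b w ih =>
    cases b with
    | none =>
      refine ⟨fun F hF => ih.2 F hF, fun F hF => ?_⟩
      have h1 : UZ l (Sph m) (fun n => Wd w ((∑ i, X i * X i) * F n)) :=
        (hF.mul (∑ i, X i * X i)).SN w
      have h2 : UZ l (Sph m) (fun n => C (-((m : ℝ) - 2)) * Wd w (D (Dir hm (F n)))) :=
        (ih.2 F hF).mul Sph_subset _
      have h3 : UZ l (Sph m) (fun n => C (-(1 / 2) : ℝ) *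
          ∑ i, ∑ j, Wd w (Dir hm (L i j (L i j (F n))))) :=
        (UZ.sum _ fun i => UZ.sum _ fun j => ih.1 _ ((hF.L i j).L i j)).mul Sph_subset _
      refine ((h1.add h2).add h3).congr fun n x _ => ?_
      have e := rsq_lap (Dir hm (F n))
      rw [lap_Dir] at e
      have e2 : D (D (Dir hm (F n))) = (∑ i, X i * X i) * F n
          + (-((m : ℝ) - 2)) • D (Dir hm (F n))
          + (-(1 / 2) : ℝ) • ∑ i, ∑ j, Dir hm (L i j (L i j (F n))) := by
        simp only [L_Dir] at e
        have hh : (C (1 / 2) : Pl m) * 2 = 1 := by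
          rw [← map_ofNat C 2, ← C_mul]; norm_num
        have hc : (C (m : ℝ) : Pl m) = (m : Pl m) := by simp
        simp only [smul_eq_C_mul, map_neg, map_sub, hc, map_ofNat]
        linear_combination (-(C (1 / 2))) * e +
          ((∑ i, X i * X i) * F n - D (D (Dir hm (F n))) - ((m : Pl m) - 2) * D (Dir hm (F n))) * hh
      refine congrArg (ev x) ?_
      change Wd w (D (D (Dir hm (F n)))) = _
      rw [e2]
      simp only [map_add, map_smul, map_sum]
      simp only [smul_eq_C_mul]
    | some p =>
      refine ⟨fun F hF => ?_, fun F hF => ?_⟩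
      · have := ih.1 _ (hF.L p.1 p.2)
        simp only [← L_Dir] at this
        exact this
      · have := ih.2 _ (hF.L p.1 p.2)
        simp only [← L_Dir, ← D_L] at this
        exact this

lemma lap_dw (w : List (Fin m)) (P : Pl m) : lapP (dw w P) = dw w (lapP P) := by
  induction w generalizing P with
  | nil => rfl
  | cons i w ih => rw [dw_cons, ih, lap_pd, dw_cons]

/-- The Dirichlet solution operator is continuous for `C^∞` convergence. -/
lemma Null.Dir (hm : 2 ≤ m) {F : ι → Pl m} (hF : Null l F) : Null l (fun n => Dir hm (F n)) := by
  have hSN : SVT.SN l (fun n => SVT.Dir hm (F n)) := fun w => (Dir_SN_aux hm w).1 F hF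
  intro w ε hε
  filter_upwards [hF w (ε / 2) (by positivity), (hSN.dw w) [] (ε / 2) (by positivity)]
    with n h1 h2 x hx
  have := mp_bound hm (v := dw w (SVT.Dir hm (F n))) (M := ε / 2) (b := ε / 2)
    (fun y hy => by rw [lap_dw, lap_Dir]; exact h1 y hy) h2 x hx
  have hb := bd_bounds hx
  nlinarith

lemma smul_mem_Ball {x : E m} (hx : x ∈ Ball m) {s : ℝ} (h0 : 0 ≤ s) (h1 : s ≤ 1) :
    s • x ∈ Ball m := by
  rw [mem_Ball, norm_smul, Real.norm_of_nonneg h0]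
  have := mem_Ball.1 hx
  nlinarith [norm_nonneg x]

lemma hasDerivAt_ray (P : Pl m) (x : E m) (s : ℝ) :
    HasDerivAt (fun s : ℝ => ev (s • x) P) (∑ i, ev (s • x) (pderiv i P) * x i) s := by
  simpa using hasDerivAt_line P 0 x s

lemma J_bound (k : ℕ) {P : Pl m} {M : ℝ} (h : ∀ x ∈ Ball m, |ev x P| ≤ M) :
    ∀ x ∈ Ball m, |ev x (J ((k : ℝ) + 1) P)| ≤ M := by
  intro x hx
  set v := J ((k : ℝ) + 1) P with hv
  have hDv : D v + C ((k : ℝ) + 1) * v = P := D_J (by positivity) P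
  have hd : ∀ s : ℝ, HasDerivAt (fun s : ℝ => s ^ (k + 1) * ev (s • x) v)
      (s ^ k * ev (s • x) P) s := by
    intro s
    have := (hasDerivAt_pow (k + 1) s).mul (hasDerivAt_ray v x s)
    refine HasDerivAt.congr_deriv this ?_
    rw [← hDv, D_apply]
    simp only [map_add, map_mul, map_sum, ev_X, ev_C, PiLp.smul_apply, smul_eq_mul]
    have : ∑ i, s * x i * ev (s • x) (pderiv i v) = s * ∑ i, ev (s • x) (pderiv i v) * x i := by
      rw [Finset.mul_sum]; exact Finset.sum_congr rfl fun i _ => by ring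
    rw [this]; push_cast; ring
  have := norm_image_sub_le_of_norm_deriv_le_segment_01' (C := M)
    (fun s _ => (hd s).hasDerivWithinAt) (fun s hs => by
      rw [Real.norm_eq_abs, abs_mul, abs_pow, abs_of_nonneg hs.1]
      have h1 := h _ (smul_mem_Ball hx hs.1 hs.2.le)
      have h2 : s ^ k ≤ 1 := pow_le_one₀ hs.1 hs.2.le
      have h3 : 0 ≤ s ^ k := pow_nonneg hs.1 k
      nlinarith [abs_nonneg (ev (s • x) P)])
  simpa using this

lemma cc_J0 (P : Pl m) : constantCoeff (J 0 P) = 0 := by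
  induction P using MvPolynomial.induction_on' with
  | monomial α a =>
    rw [J_monomial, constantCoeff_eq, coeff_monomial]
    split_ifs with h
    · subst h; simp
    · rfl
  | add p q hp hq => rw [map_add, map_add, hp, hq, add_zero]

lemma coord_le {x : E m} (hx : x ∈ Ball m) (i : Fin m) : |x i| ≤ 1 :=
  (PiLp.norm_apply_le x i).trans (mem_Ball.1 hx)

lemma grad_bound {P : Pl m} {M : ℝ} (h0 : constantCoeff P = 0)
    (h : ∀ i, ∀ x ∈ Ball m, |ev x (pderiv i P)| ≤ M) :
    ∀ x ∈ Ball m, |ev x P| ≤ m * M := by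
  intro x hx
  have := norm_image_sub_le_of_norm_deriv_le_segment_01' (C := m * M)
    (fun s _ => (hasDerivAt_ray P x s).hasDerivWithinAt) (fun s hs => by
      rw [Real.norm_eq_abs]
      refine (Finset.abs_sum_le_sum_abs _ _).trans ?_
      calc _ ≤ ∑ i : Fin m, M := by
            refine Finset.sum_le_sum fun i _ => ?_
            rw [abs_mul]
            have h1 := h i _ (smul_mem_Ball hx hs.1 hs.2.le)
            nlinarith [abs_nonneg (ev (s • x) (pderiv i P)), coord_le hx i, abs_nonneg (x i)]
        _ = m * M := by simp)
  simpa [ev_zero, h0] using this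

lemma Null.J (k : ℕ) {P : ι → Pl m} (hP : Null l P) : Null l (fun n => J (k : ℝ) (P n)) := by
  have hpos : ∀ (w : List (Fin m)) (k : ℕ) (P : ι → Pl m), Null l P →
      UZ l (Ball m) (fun n => SVT.dw w (SVT.J ((k : ℝ) + 1) (P n))) := by
    intro w
    induction w with
    | nil =>
      intro k P hP ε hε
      filter_upwards [hP [] ε hε] with n hn x hx
      exact J_bound k hn x hx
    | cons i w ih =>
      intro k P hP
      have := ih (k + 1) _ (hP.pd i)
      simp only [dw_cons]
      have hk : (0 : ℝ) ≤ (k : ℝ) + 1 := by positivity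
      simp only [pd_J hk]
      push_cast at this
      exact this
  cases k with
  | succ k =>
    intro w
    push_cast
    exact hpos w k P hP
  | zero =>
    intro w
    simp only [Nat.cast_zero]
    cases w with
    | nil =>
      intro ε hε
      have hall : ∀ᶠ n in l, ∀ i, ∀ x ∈ Ball m,
          |ev x (pderiv i (SVT.J 0 (P n)))| ≤ ε / (m + 1) := by
        rw [eventually_all]
        intro i
        have := hpos [] 0 _ (hP.pd i) (ε / (m + 1)) (by positivity)
        simp only [pd_J le_rfl]
        simpa using this
      filter_upwards [hall] with n hn x hx
      refine (grad_bound (cc_J0 _) hn x hx).trans ?_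
      rw [mul_div_assoc', div_le_iff₀ (by positivity)]
      nlinarith [(Nat.cast_nonneg m : (0 : ℝ) ≤ m)]
    | cons i w =>
      have := hpos w 0 _ (hP.pd i)
      simp only [dw_cons, pd_J le_rfl]
      simpa using this

end estimates

end SVT

namespace SVT

open MvPolynomial Filter Topology

section solution
variable {m : ℕ}

/-- Radial component. -/
def dot (f : Fin m → Pl m) : Pl m := ∑ i, X i * f i

/-- Divergence. -/
def dv (f : Fin m → Pl m) : Pl m := ∑ i, pderiv i (f i)

lemma lap_dot (f : Fin m → Pl m) : lapP (dot f) = dot (fun i => lapP (f i)) + 2 * dv f := by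
  simp only [dot, dv, map_sum, lap_X_mul, Finset.sum_add_distrib, Finset.mul_sum]

lemma D_dot (f : Fin m → Pl m) : D (dot f) = dot (fun i => D (f i)) + dot f := by
  simp only [dot, map_sum, D_mul, D_X, ← Finset.sum_add_distrib]
  exact Finset.sum_congr rfl fun i _ => by ring

lemma dv_D (f : Fin m → Pl m) : dv (fun i => D (f i)) = D (dv f) + dv f := by
  simp only [dv, map_sum, pd_D, ← Finset.sum_add_distrib]

lemma lap_dv (f : Fin m → Pl m) : lapP (dv f) = dv (fun i => lapP (f i)) := by
  simp only [dv, map_sum, lap_pd]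

lemma dv_grad (P : Pl m) : dv (fun i => pderiv i P) = lapP P := by
  simp only [dv, lapP_apply]

lemma dot_grad (P : Pl m) : dot (fun i => pderiv i P) = D P := by
  simp only [dot, D_apply]

lemma dot_add (f g : Fin m → Pl m) : dot (fun i => f i + g i) = dot f + dot g := by
  simp only [dot, mul_add, Finset.sum_add_distrib]

lemma dot_sub (f g : Fin m → Pl m) : dot (fun i => f i - g i) = dot f - dot g := by
  simp only [dot, mul_sub, Finset.sum_sub_distrib]

lemma dot_mul (c : Pl m) (f : Fin m → Pl m) : dot (fun i => c * f i) = c * dot f := by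
  simp only [dot, Finset.mul_sum]
  exact Finset.sum_congr rfl fun i _ => by ring

lemma dv_add (f g : Fin m → Pl m) : dv (fun i => f i + g i) = dv f + dv g := by
  simp only [dv, map_add, Finset.sum_add_distrib]

lemma dv_sub (f g : Fin m → Pl m) : dv (fun i => f i - g i) = dv f - dv g := by
  simp only [dv, map_sub, Finset.sum_sub_distrib]

lemma dv_two (f : Fin m → Pl m) : dv (fun i => 2 * f i) = 2 * dv f := by
  simp only [dv, pderiv_mul, pd_two, Finset.mul_sum]
  exact Finset.sum_congr rfl fun i _ => by ring

lemma dv_C (c : ℝ) (f : Fin m → Pl m) : dv (fun i => C c * f i) = C c * dv f := by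
  simp only [dv, pderiv_C_mul, Finset.mul_sum]

lemma lap_two (P : Pl m) : lapP (2 * P) = 2 * lapP P := by
  rw [two_mul, map_add, two_mul]

lemma cc_dot (f : Fin m → Pl m) : constantCoeff (dot f) = 0 := by
  simp [dot]

lemma pd_dot (l : Fin m) (f : Fin m → Pl m) :
    pderiv l (dot f) = f l + ∑ k, X k * pderiv l (f k) := by
  simp only [dot, map_sum, pderiv_mul, Finset.sum_add_distrib]
  congr 1
  rw [Finset.sum_eq_single l]
  · simp
  · intro k _ hk; rw [pderiv_X_of_ne hk, zero_mul]
  · simp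

lemma curl_id (f : Fin m → Pl m) :
    D (dv f) + 2 * dv f - lapP (dot f) = ∑ l, ∑ k, L l k (pderiv l (f k)) := by
  rw [lap_dot]
  simp only [L_apply, Finset.sum_sub_distrib]
  have h1 : D (dv f) = ∑ l, ∑ k, X l * pderiv k (pderiv l (f k)) := by
    rw [Finset.sum_comm]
    simp only [D_apply, dv, map_sum]
    exact Finset.sum_congr rfl fun l _ => Finset.sum_congr rfl fun k _ => by rw [pd_comm]
  have h2 : dot (fun i => lapP (f i)) = ∑ l, ∑ k, X k * pderiv l (pderiv l (f k)) := by
    rw [Finset.sum_comm]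
    simp only [dot, lapP_apply, Finset.mul_sum]
  rw [h1, h2]; ring

/-- Radial derivative of the potential. -/
def qF (hm : 2 ≤ m) (f : Fin m → Pl m) : Pl m :=
  dot f + Dir hm (D (dv f) + 2 * dv f - lapP (dot f))

lemma cc_qF (hm : 2 ≤ m) (f : Fin m → Pl m) : constantCoeff (qF hm f) = 0 := by
  rw [qF, curl_id]
  simp only [map_add, cc_dot, map_sum, ← L_Dir, cc_L]
  simp

/-- The scalar potential. -/
def pF (hm : 2 ≤ m) (f : Fin m → Pl m) : Pl m := J 0 (qF hm f)

lemma D_pF (hm : 2 ≤ m) (f : Fin m → Pl m) : D (pF hm f) = qF hm f := by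
  rw [pF, D_J0, cc_qF]; simp

lemma lap_pF (hm : 2 ≤ m) (f : Fin m → Pl m) : lapP (pF hm f) = dv f := by
  apply D_inj (c := 2) (by norm_num)
  have h := lap_D (pF hm f)
  rw [D_pF, qF, map_add, lap_Dir] at h
  rw [map_ofNat]
  linear_combination -h

/-- The divergence-free remainder. -/
def gF (hm : 2 ≤ m) (f : Fin m → Pl m) (j : Fin m) : Pl m := f j - pderiv j (pF hm f)

lemma dv_gF (hm : 2 ≤ m) (f : Fin m → Pl m) : dv (gF hm f) = 0 := by
  have : gF hm f = fun j => f j - pderiv j (pF hm f) := rfl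
  rw [this, dv_sub, dv_grad, lap_pF, sub_self]

lemma dot_gF (hm : 2 ≤ m) (f : Fin m → Pl m) : ∃ Q, dot (gF hm f) = bd m * Q := by
  have : gF hm f = fun j => f j - pderiv j (pF hm f) := rfl
  refine ⟨- Dq hm (D (dv f) + 2 * dv f - lapP (dot f)), ?_⟩
  rw [this, dot_sub, dot_grad, D_pF, qF, Dir_eq]; ring

lemma rot_id (g : Fin m → Pl m) (hg : dv g = 0) :
    D (dot g) + C ((m : ℝ) - 2) * dot g + ∑ l, ∑ k, L l k (X l * g k) = 0 := by
  have h1 : ∀ l k : Fin m, L l k (X l * g k) = (if l = k then X l * g k else 0)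
      + X l * X l * pderiv k (g k) - X k * g k - X l * (X k * pderiv l (g k)) := by
    intro l k
    rw [L_apply, pderiv_mul, pderiv_mul, pderiv_X_self]
    by_cases h : l = k
    · subst h; simp; ring
    · rw [pderiv_X_of_ne h, if_neg h]; ring
  simp only [h1, Finset.sum_sub_distrib, Finset.sum_add_distrib]
  have h2 : ∑ l : Fin m, ∑ k : Fin m, X l * X l * pderiv k (g k) = 0 := by
    simp only [← Finset.mul_sum]
    simp only [dv] at hg
    simp [hg]
  have h3 : ∑ l : Fin m, ∑ k : Fin m, X l * (X k * pderiv l (g k)) = dot (fun k => D (g k)) := by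
    rw [Finset.sum_comm]
    simp only [dot, D_apply, Finset.mul_sum]
    exact Finset.sum_congr rfl fun l _ => Finset.sum_congr rfl fun k _ => by ring
  have h4 : ∑ l : Fin m, ∑ k : Fin m, (if l = k then X l * g k else 0) = dot g := by
    simp [dot]
  have h5 : ∑ l : Fin m, ∑ k : Fin m, X k * g k = (m : Pl m) * dot g := by
    simp [dot]
  rw [h2, h3, h4, h5, D_dot]
  have hc : (C (m : ℝ) : Pl m) = (m : Pl m) := by simp
  rw [map_sub, hc, map_ofNat]; ring

/-- Radial part of the vector potential. -/
def sF (hm : 2 ≤ m) (g : Fin m → Pl m) : Pl m := Dir hm (2 * dot g)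

lemma cc_sF (hm : 2 ≤ m) (g : Fin m → Pl m) (hg : dv g = 0) : constantCoeff (sF hm g) = 0 := by
  have hm' : (0 : ℝ) ≤ (m : ℝ) - 2 := by
    have : (2 : ℝ) ≤ m := by exact_mod_cast hm
    linarith
  have hψ : ∀ l k : Fin m, D (J ((m : ℝ) - 2) (X l * g k)) +
      C ((m : ℝ) - 2) * J ((m : ℝ) - 2) (X l * g k) = X l * g k :=
    fun l k => D_J' hm' (by simp)
  have h0 : dot g + ∑ l, ∑ k, L l k (J ((m : ℝ) - 2) (X l * g k)) = 0 := by
    apply D_inj' hm'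
    · simp only [map_add, map_sum, cc_dot, cc_L]; simp
    · rw [← rot_id g hg]
      have : ∀ l k : Fin m, L l k (X l * g k) = D (L l k (J ((m : ℝ) - 2) (X l * g k)))
          + C ((m : ℝ) - 2) * L l k (J ((m : ℝ) - 2) (X l * g k)) := by
        intro l k
        conv_lhs => rw [← hψ l k]
        rw [map_add, D_L, ← smul_eq_C_mul, ← smul_eq_C_mul, Derivation.map_smul]
      simp only [this, Finset.sum_add_distrib, map_add, map_sum, mul_add, Finset.mul_sum]
      ring
  have h1 : dot g = - ∑ l, ∑ k, L l k (J ((m : ℝ) - 2) (X l * g k)) := by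
    linear_combination h0
  rw [sF, two_mul, map_add, map_add, h1]
  simp only [map_neg, map_sum, ← L_Dir, cc_L]
  simp

/-- Tangential part of the vector potential. -/
def yF (hm : 2 ≤ m) (g : Fin m → Pl m) (j : Fin m) : Pl m :=
  Dir hm (2 * (D (g j) + 3 * g j - pderiv j (dot g)))

lemma yF_main (hm : 2 ≤ m) (g : Fin m → Pl m) (hg : dv g = 0) (Q : Pl m)
    (hQ : dot g = bd m * Q) :
    dot (yF hm g) = 0 ∧ dv (yF hm g) + 2 * dot g = 0 := by
  have hm' : (2 : ℝ) ≤ m := by exact_mod_cast hm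
  set h := dv (yF hm g) + 2 * dot g with hh
  have ly : ∀ j, lapP (yF hm g j) = 2 * (D (g j) + 3 * g j - pderiv j (dot g)) :=
    fun j => lap_Dir hm _
  have e3 : ∀ f : Fin m → Pl m, dv (fun i => 3 * f i) = 3 * dv f := by
    intro f
    simpa only [map_ofNat] using dv_C 3 f
  have hlap : lapP h = 0 := by
    rw [hh, map_add, lap_dv, lap_two]
    simp only [ly]
    rw [dv_two, dv_sub, dv_add, dv_D, e3, dv_grad, hg]
    simp
  have hz : lapP (dot (yF hm g)) = 2 * h := by
    rw [lap_dot]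
    simp only [ly]
    rw [dot_mul, dot_sub, dot_add, dot_mul, dot_grad, D_dot, hh]
    ring
  let Yj : Fin m → Pl m := fun j => Dq hm (2 * (D (g j) + 3 * g j - pderiv j (dot g)))
  have hY : yF hm g = fun j => bd m * Yj j := rfl
  have hzY : dot (yF hm g) = bd m * dot Yj := by rw [hY, dot_mul]
  have hdY : dv (yF hm g) = -2 * dot Yj + bd m * dv Yj := by
    rw [hY]
    simp only [dv, dot, pderiv_mul, pd_bd, Finset.mul_sum, ← Finset.sum_add_distrib]
    exact Finset.sum_congr rfl fun i _ => by ring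
  set b := J ((m : ℝ) / 2) h with hb
  have hDb : D b + C ((m : ℝ) / 2) * b = h := D_J (by linarith) h
  have hlb : lapP b = 0 := by
    apply D_inj (c := (m : ℝ) / 2 + 2) (by linarith)
    have := congrArg lapP hDb
    rw [map_add, lap_D, lap_C_mul, hlap] at this
    rw [map_zero, map_add, map_ofNat]
    linear_combination this
  have hc : (C ((m : ℝ) / 2) : Pl m) * 2 = (m : Pl m) := by
    rw [← map_ofNat C 2, ← C_mul, div_mul_cancel₀ _ (two_ne_zero)]; simp
  have h1 : 2 * dot Yj + b = 0 := by
    apply bd_harm hm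
    rw [mul_add, map_add, lap_bd_mul b, hlb, mul_left_comm, lap_two, ← hzY, hz]
    linear_combination -4 * hDb + 2 * b * hc
  have h2 : dv Yj + 2 * Q = 0 := by
    apply bd_harm hm
    have : bd m * (dv Yj + 2 * Q) = h - b := by
      rw [hh, hdY, hQ]; linear_combination h1
    rw [this, map_sub, hlap, hlb, sub_zero]
  have h3 : h = b := by
    rw [hh, hdY, hQ]; linear_combination -h1 + bd m * h2
  have hcb : constantCoeff b = 0 := by
    have e1 := congrArg constantCoeff h1
    simpa [cc_dot] using e1
  have hb0 : b = 0 := by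
    apply D_inj' (c := (m : ℝ) / 2 - 1) (by linarith) hcb
    rw [map_sub, map_one]
    linear_combination hDb + h3
  refine ⟨?_, by rw [h3, hb0]⟩
  have h4 : bd m * (2 * dot Yj) = 0 := by
    rw [hb0, add_zero] at h1
    rw [h1, mul_zero]
  have : (2 : Pl m) * dot (yF hm g) = 0 := by rw [hzY]; linear_combination h4
  exact (mul_eq_zero.1 this).resolve_left two_ne_zero

/-- The vector potential. -/
def wF (hm : 2 ≤ m) (g : Fin m → Pl m) (j : Fin m) : Pl m :=
  J 1 (yF hm g j + pderiv j (sF hm g))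

lemma D_wF (hm : 2 ≤ m) (g : Fin m → Pl m) (j : Fin m) :
    D (wF hm g j) + wF hm g j = yF hm g j + pderiv j (sF hm g) := by
  have := D_J (c := 1) one_pos (yF hm g j + pderiv j (sF hm g))
  rw [map_one, one_mul] at this
  exact this

lemma wF_main (hm : 2 ≤ m) (g : Fin m → Pl m) (hg : dv g = 0) (Q : Pl m)
    (hQ : dot g = bd m * Q) :
    dv (wF hm g) = 0 ∧ (∀ j, lapP (wF hm g j) = 2 * g j) ∧ dot (wF hm g) = sF hm g ∧
    ∀ l, ∑ k, X k * (pderiv k (wF hm g l) - pderiv l (wF hm g k)) = yF hm g l := by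
  obtain ⟨hy1, hy2⟩ := yF_main hm g hg Q hQ
  have hD := D_wF hm g
  have ls : lapP (sF hm g) = 2 * dot g := lap_Dir hm _
  have hdiv : dv (wF hm g) = 0 := by
    apply D_inj (c := 2) (by norm_num)
    have e := congrArg dv (funext hD)
    rw [dv_add, dv_add, dv_D, dv_grad, ls] at e
    rw [map_ofNat, map_zero]
    have e2 : dv (fun i => yF hm g i) = dv (yF hm g) := rfl
    have e3 : dv (fun i => wF hm g i) = dv (wF hm g) := rfl
    rw [e2, e3] at e
    linear_combination e + hy2
  have hdot : dot (wF hm g) = sF hm g := by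
    have e := congrArg dot (funext hD)
    rw [dot_add, dot_add, dot_grad] at e
    have e2 : dot (fun i => yF hm g i) = dot (yF hm g) := rfl
    have e3 : dot (fun i => wF hm g i) = dot (wF hm g) := rfl
    rw [e2, e3, hy1] at e
    have : dot (wF hm g) - sF hm g = 0 := by
      apply D_inj' (c := 0) le_rfl
      · rw [map_sub, cc_dot, cc_sF hm g hg, sub_zero]
      · rw [map_sub, D_dot, map_zero]; linear_combination e
    exact sub_eq_zero.1 this
  refine ⟨hdiv, fun j => ?_, hdot, fun l => ?_⟩
  · apply D_inj (c := 3) (by norm_num)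
    have e := congrArg lapP (hD j)
    rw [map_add, map_add, lap_D, lap_pd, ls] at e
    have ly : lapP (yF hm g j) = 2 * (D (g j) + 3 * g j - pderiv j (dot g)) := lap_Dir hm _
    have ep : pderiv j (2 * dot g) = 2 * pderiv j (dot g) := by
      rw [pderiv_mul, pd_two]; ring
    have ed : D (2 * g j) = 2 * D (g j) := by rw [two_mul, map_add, two_mul]
    rw [ly, ep] at e
    rw [map_ofNat, ed]
    linear_combination e
  · have e1 := pd_dot l (wF hm g)
    have e2 := hD l
    rw [D_apply] at e2
    rw [hdot] at e1
    simp only [mul_sub, Finset.sum_sub_distrib]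
    linear_combination e2 + e1

/-- The scalar potential `u`. -/
def uF (hm : 2 ≤ m) (f : Fin m → Pl m) : Pl m :=
  Dir hm (C ((m : ℝ) / (m - 1)) * pF hm f)

/-- Divergence of a tensor. -/
def divT (t : Fin m → Fin m → Pl m) (j : Fin m) : Pl m := ∑ i, pderiv i (t i j)

/-- Polynomial traceless Hessian plus symmetrised gradient. -/
def stP (u : Pl m) (w : Fin m → Pl m) (i j : Fin m) : Pl m :=
  pderiv i (pderiv j u) - C ((if i = j then (1 : ℝ) else 0) / m) * lapP u
    + C (1 / 2) * (pderiv i (w j) + pderiv j (w i))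

lemma divT_stP (u : Pl m) (w : Fin m → Pl m) (j : Fin m) :
    divT (stP u w) j = C (1 - 1 / (m : ℝ)) * pderiv j (lapP u)
      + C (1 / 2) * (lapP (w j) + pderiv j (dv w)) := by
  simp only [divT, stP, map_add, map_sub, pderiv_C_mul, Finset.sum_add_distrib,
    Finset.sum_sub_distrib, ← Finset.mul_sum]
  have h1 : ∑ i, pderiv i (pderiv i (pderiv j u)) = pderiv j (lapP u) := by
    rw [← lap_pd, lapP_apply]
  have h2 : ∑ i, C ((if i = j then (1 : ℝ) else 0) / m) * pderiv i (lapP u)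
      = C (1 / (m : ℝ)) * pderiv j (lapP u) := by
    rw [Finset.sum_eq_single j]
    · simp
    · intro k _ hk; simp [hk]
    · simp
  have h3 : ∑ i, pderiv i (pderiv i (w j)) = lapP (w j) := by rw [lapP_apply]
  have h4 : ∑ i, pderiv i (pderiv j (w i)) = pderiv j (dv w) := by
    simp only [dv, map_sum]
    exact Finset.sum_congr rfl fun i _ => pd_comm _ _ _
  rw [h1, h2, h3, h4, map_one]; ring

lemma solution_div (hm : 2 ≤ m) (f : Fin m → Pl m) (j : Fin m) :
    divT (stP (uF hm f) (wF hm (gF hm f))) j = f j := by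
  obtain ⟨Q, hQ⟩ := dot_gF hm f
  obtain ⟨h1, h2, -, -⟩ := wF_main hm (gF hm f) (dv_gF hm f) Q hQ
  have hm' : (2 : ℝ) ≤ m := by exact_mod_cast hm
  have hu : lapP (uF hm f) = C ((m : ℝ) / (m - 1)) * pF hm f := lap_Dir hm _
  rw [divT_stP, h1, h2, hu, pderiv_C_mul]
  have hc : (C (1 - 1 / (m : ℝ)) : Pl m) * C ((m : ℝ) / (m - 1)) = 1 := by
    rw [← C_mul, ← C_1]; congr 1
    have : (m : ℝ) - 1 ≠ 0 := by linarith
    have : (m : ℝ) ≠ 0 := by linarith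
    field_simp
  have hc2 : (C (1 / 2 : ℝ) : Pl m) * 2 = 1 := by
    rw [← map_ofNat C 2, ← C_mul, ← C_1]; congr 1; norm_num
  rw [map_zero, add_zero]
  have hg : gF hm f j = f j - pderiv j (pF hm f) := rfl
  linear_combination pderiv j (pF hm f) * hc + gF hm f j * hc2 + hg

end solution

end SVT

namespace SVT

open MvPolynomial Filter Topology

section limits
variable {m : ℕ}

/-- Cauchy sequences for `C^∞` convergence on the ball. -/
def Cau (P : ℕ → Pl m) : Prop :=
  Null (atTop ×ˢ atTop) (fun nk : ℕ × ℕ => P nk.1 - P nk.2)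

lemma Cau.pd {P : ℕ → Pl m} (h : Cau P) (i : Fin m) : Cau (fun n => pderiv i (P n)) := by
  unfold Cau
  simp only [← map_sub]
  exact Null.pd h i

lemma Cau.D {P : ℕ → Pl m} (h : Cau P) : Cau (fun n => D (P n)) := by
  unfold Cau
  simp only [← map_sub]
  exact Null.D h

lemma Cau.Dir (hm : 2 ≤ m) {P : ℕ → Pl m} (h : Cau P) : Cau (fun n => Dir hm (P n)) := by
  unfold Cau
  simp only [← map_sub]
  exact Null.Dir hm h

lemma Cau.J (k : ℕ) {P : ℕ → Pl m} (h : Cau P) : Cau (fun n => J (k : ℝ) (P n)) := by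
  unfold Cau
  simp only [← map_sub]
  exact Null.J k h

lemma Cau.mul (Q : Pl m) {P : ℕ → Pl m} (h : Cau P) : Cau (fun n => Q * P n) := by
  unfold Cau
  simp only [← mul_sub]
  exact Null.mul Q h

lemma Cau.add {P Q : ℕ → Pl m} (h : Cau P) (h' : Cau Q) : Cau (fun n => P n + Q n) := by
  unfold Cau
  simp only [add_sub_add_comm]
  exact Null.add h h'

lemma Cau.sub {P Q : ℕ → Pl m} (h : Cau P) (h' : Cau Q) : Cau (fun n => P n - Q n) := by
  unfold Cau
  simp only [sub_sub_sub_comm]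
  exact Null.sub h h'

lemma Cau.sum {κ : Type} (s : Finset κ) {P : κ → ℕ → Pl m} (h : ∀ k, Cau (P k)) :
    Cau (fun n => ∑ k ∈ s, P k n) := by
  unfold Cau
  simp only [← Finset.sum_sub_distrib]
  exact Null.sum s h

lemma Cau.lap {P : ℕ → Pl m} (h : Cau P) : Cau (fun n => lapP (P n)) := by
  simp only [lapP_apply]
  exact Cau.sum _ fun i => (h.pd i).pd i

/-- The polynomials `P n` converge in `C^∞` of the ball to `f`. -/
def Lim (P : ℕ → Pl m) (f : E m → ℝ) : Prop :=
  Cau P ∧ ∀ x ∈ Ball m, Tendsto (fun n => ev x (P n)) atTop (𝓝 (f x))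

lemma Cau.unif {P : ℕ → Pl m} (h : Cau P) {ε : ℝ} (hε : 0 < ε) :
    ∃ N, ∀ n ≥ N, ∀ k ≥ N, ∀ x ∈ Ball m, |ev x (P n) - ev x (P k)| ≤ ε := by
  have := h [] ε hε
  rw [prod_atTop_atTop_eq, eventually_atTop] at this
  obtain ⟨⟨a, b⟩, hab⟩ := this
  refine ⟨max a b, fun n hn k hk x hx => ?_⟩
  have := hab (n, k) ⟨(le_max_left _ _).trans hn, (le_max_right _ _).trans hk⟩ x hx
  simpa using this

lemma Cau.exists_lim {P : ℕ → Pl m} (h : Cau P) : ∃ f, Lim P f := by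
  have : ∀ x : E m, ∃ y : ℝ, x ∈ Ball m → Tendsto (fun n => ev x (P n)) atTop (𝓝 y) := by
    intro x
    by_cases hx : x ∈ Ball m
    · have hc : CauchySeq (fun n => ev x (P n)) := by
        rw [Metric.cauchySeq_iff]
        intro ε hε
        obtain ⟨N, hN⟩ := h.unif (half_pos hε)
        refine ⟨N, fun n hn k hk => ?_⟩
        rw [Real.dist_eq]
        linarith [hN n hn k hk x hx]
      obtain ⟨y, hy⟩ := cauchySeq_tendsto_of_complete hc
      exact ⟨y, fun _ => hy⟩
    · exact ⟨0, fun h => absurd h hx⟩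
  choose f hf using this
  exact ⟨f, h, fun x hx => hf x hx⟩

lemma Lim.unif {P : ℕ → Pl m} {f : E m → ℝ} (h : Lim P f) {ε : ℝ} (hε : 0 < ε) :
    ∃ N, ∀ n ≥ N, ∀ x ∈ Ball m, |ev x (P n) - f x| ≤ ε := by
  obtain ⟨N, hN⟩ := h.1.unif hε
  refine ⟨N, fun n hn x hx => ?_⟩
  have h1 : Tendsto (fun k => |ev x (P n) - ev x (P k)|) atTop (𝓝 |ev x (P n) - f x|) :=
    (tendsto_const_nhds.sub (h.2 x hx)).abs
  refine le_of_tendsto h1 ?_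
  filter_upwards [eventually_ge_atTop N] with k hk
  exact hN n hn k hk x hx

lemma Lim.unique {P : ℕ → Pl m} {f g : E m → ℝ} (h : Lim P f) (h' : Lim P g) :
    ∀ x ∈ Ball m, f x = g x := fun x hx => tendsto_nhds_unique (h.2 x hx) (h'.2 x hx)

lemma convex_Ball : Convex ℝ (Ball m) := convex_closedBall 0 1

lemma uniqueDiff_Ball : UniqueDiffOn ℝ (Ball m) := by
  apply uniqueDiffOn_convex convex_Ball
  refine ⟨0, ?_⟩
  rw [Ball, interior_closedBall _ one_ne_zero]
  simp

lemma dev_bound {P : Pl m} {x : E m} {M : ℝ} (h : ∀ i, |ev x (pderiv i P)| ≤ M) :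
    ‖dev P x‖ ≤ m * M := by
  by_cases hm : m = 0
  · subst hm
    have : dev P x = 0 := by ext v; simp [dev_apply]
    simp [this]
  have hM : 0 ≤ M := (abs_nonneg _).trans (h ⟨0, Nat.pos_of_ne_zero hm⟩)
  refine ContinuousLinearMap.opNorm_le_bound _ (by positivity) fun v => ?_
  rw [dev_apply, Real.norm_eq_abs]
  refine (Finset.abs_sum_le_sum_abs _ _).trans ?_
  calc _ ≤ ∑ i : Fin m, M * ‖v‖ := by
        refine Finset.sum_le_sum fun i _ => ?_
        rw [abs_mul]
        exact mul_le_mul (h i) (PiLp.norm_apply_le v i) (abs_nonneg _) hM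
    _ = m * M * ‖v‖ := by simp; ring

/-- The candidate derivative. -/
def lin (a : Fin m → ℝ) : E m →L[ℝ] ℝ := ∑ i, a i • EuclideanSpace.proj i

lemma lin_apply (a : Fin m → ℝ) (v : E m) : lin a v = ∑ i, a i * v i := by
  simp [lin]

lemma Lim.hasFDerivWithinAt {P : ℕ → Pl m} {f : E m → ℝ} {g : Fin m → E m → ℝ}
    (h : Lim P f) (hg : ∀ i, Lim (fun n => pderiv i (P n)) (g i)) {x : E m} (hx : x ∈ Ball m) :
    HasFDerivWithinAt f (lin (fun i => g i x)) (Ball m) x := by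
  rw [hasFDerivWithinAt_iff_isLittleO, Asymptotics.isLittleO_iff]
  intro c hc
  set ε := c / (3 * (m + 1)) with hε
  have hε0 : 0 < ε := by positivity
  choose N hN using fun i => (hg i).unif hε0
  choose N' hN' using fun i => (hg i).1.unif hε0
  set K := (∑ i, N i) + ∑ i, N' i with hK
  have hKN : ∀ i, N i ≤ K := fun i =>
    (Finset.single_le_sum (f := N) (fun _ _ => Nat.zero_le _) (Finset.mem_univ i)).trans
      (Nat.le_add_right _ _)
  have hKN' : ∀ i, N' i ≤ K := fun i =>
    (Finset.single_le_sum (f := N') (fun _ _ => Nat.zero_le _) (Finset.mem_univ i)).trans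
      (Nat.le_add_left _ _)
  have hmv : ∀ k ≥ K, ∀ y ∈ Ball m,
      |(ev y (P K - P k)) - ev x (P K - P k)| ≤ m * ε * ‖y - x‖ := by
    intro k hk y hy
    refine convex_Ball.norm_image_sub_le_of_norm_hasFDerivWithin_le
      (f := fun y => ev y (P K - P k))
      (fun z _ => (hasFDerivAt_ev (P K - P k) z).hasFDerivWithinAt) (fun z hz => ?_) hx hy
    refine dev_bound fun i => ?_
    rw [map_sub, map_sub]
    exact hN' i K (hKN' i) k ((hKN' i).trans hk) z hz
  have hmv2 : ∀ y ∈ Ball m, |(ev y (P K) - f y) - (ev x (P K) - f x)| ≤ m * ε * ‖y - x‖ := by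
    intro y hy
    have h1 : Tendsto (fun k => |(ev y (P K) - ev y (P k)) - (ev x (P K) - ev x (P k))|) atTop
        (𝓝 |(ev y (P K) - f y) - (ev x (P K) - f x)|) :=
      ((tendsto_const_nhds.sub (h.2 y hy)).sub (tendsto_const_nhds.sub (h.2 x hx))).abs
    refine le_of_tendsto h1 ?_
    filter_upwards [eventually_ge_atTop K] with k hk
    have := hmv k hk y hy
    simpa only [map_sub] using this
  have hlin : ∀ v : E m, |dev (P K) x v - lin (fun i => g i x) v| ≤ m * ε * ‖v‖ := by
    intro v
    rw [dev_apply, lin_apply, ← Finset.sum_sub_distrib]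
    refine (Finset.abs_sum_le_sum_abs _ _).trans ?_
    calc _ ≤ ∑ i : Fin m, ε * ‖v‖ := by
          refine Finset.sum_le_sum fun i _ => ?_
          rw [← sub_mul, abs_mul]
          exact mul_le_mul (hN i K (hKN i) x hx) (PiLp.norm_apply_le v i) (abs_nonneg _) hε0.le
      _ = m * ε * ‖v‖ := by simp; ring
  have hd := (hasFDerivAt_ev (P K) x).hasFDerivWithinAt (s := Ball m)
  rw [hasFDerivWithinAt_iff_isLittleO, Asymptotics.isLittleO_iff] at hd
  filter_upwards [hd hε0, self_mem_nhdsWithin] with y h1 hy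
  have h2 := hmv2 y hy
  have h3 := hlin (y - x)
  rw [Real.norm_eq_abs] at h1 ⊢
  have hc' : c = 3 * (m + 1) * ε := by rw [hε]; field_simp
  have h4 : 0 ≤ ε * ‖y - x‖ := by positivity
  have h5 : 0 ≤ m * (ε * ‖y - x‖) := by positivity
  have e : f y - f x - lin (fun i => g i x) (y - x) =
      (ev y (P K) - ev x (P K) - dev (P K) x (y - x))
      - ((ev y (P K) - f y) - (ev x (P K) - f x))
      + (dev (P K) x (y - x) - lin (fun i => g i x) (y - x)) := by ring
  rw [e, hc']
  refine (abs_add_le _ _).trans ?_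
  have := abs_sub (ev y (P K) - ev x (P K) - dev (P K) x (y - x))
    ((ev y (P K) - f y) - (ev x (P K) - f x))
  nlinarith

lemma Lim.pd_aux {P : ℕ → Pl m} {f : E m → ℝ} (h : Lim P f) :
    (∀ i, Lim (fun n => pderiv i (P n)) (pd i f)) ∧
    ∀ x ∈ Ball m, HasFDerivWithinAt f (lin (fun i => pd i f x)) (Ball m) x := by
  choose g hg using fun i => (h.1.pd i).exists_lim
  have e : ∀ x ∈ Ball m, ∀ i, pd i f x = g i x := by
    intro x hx i
    have h1 := (h.hasFDerivWithinAt hg hx).fderivWithin (uniqueDiff_Ball x hx)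
    rw [pd, h1, lin_apply]
    simp
  constructor
  · intro i
    refine ⟨h.1.pd i, fun x hx => ?_⟩
    rw [e x hx i]; exact (hg i).2 x hx
  · intro x hx
    have := h.hasFDerivWithinAt hg hx
    simp only [← e x hx] at this
    exact this

lemma Lim.pd {P : ℕ → Pl m} {f : E m → ℝ} (h : Lim P f) (i : Fin m) :
    Lim (fun n => pderiv i (P n)) (pd i f) := h.pd_aux.1 i

lemma Lim.contDiffOn_nat (n : ℕ) {P : ℕ → Pl m} {f : E m → ℝ} (h : Lim P f) :
    ContDiffOn ℝ n f (Ball m) := by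
  induction n generalizing P f with
  | zero =>
    rw [Nat.cast_zero, contDiffOn_zero]
    exact fun x hx => (h.pd_aux.2 x hx).continuousWithinAt
  | succ n ih =>
    rw [Nat.cast_add, Nat.cast_one, contDiffOn_succ_iff_fderivWithin uniqueDiff_Ball]
    refine ⟨fun x hx => (h.pd_aux.2 x hx).differentiableWithinAt, by simp, ?_⟩
    have h1 : ContDiffOn ℝ n (fun x => lin (fun i => _root_.pd i f x)) (Ball m) := by
      unfold lin
      exact ContDiffOn.sum fun i _ => (ih (h.pd i)).smul contDiffOn_const
    exact h1.congr fun x hx => (h.pd_aux.2 x hx).fderivWithin (uniqueDiff_Ball x hx)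

lemma Lim.contDiffOn {P : ℕ → Pl m} {f : E m → ℝ} (h : Lim P f) :
    ContDiffOn ℝ (⊤ : ℕ∞) f (Ball m) :=
  contDiffOn_infty.2 fun n => h.contDiffOn_nat n

lemma Lim.mul (Q : Pl m) {P : ℕ → Pl m} {f : E m → ℝ} (h : Lim P f) :
    Lim (fun n => Q * P n) (fun x => ev x Q * f x) := by
  refine ⟨h.1.mul Q, fun x hx => ?_⟩
  simp only [map_mul]
  exact (h.2 x hx).const_mul _

lemma Lim.add {P Q : ℕ → Pl m} {f g : E m → ℝ} (h : Lim P f) (h' : Lim Q g) :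
    Lim (fun n => P n + Q n) (fun x => f x + g x) := by
  refine ⟨h.1.add h'.1, fun x hx => ?_⟩
  simp only [map_add]
  exact (h.2 x hx).add (h'.2 x hx)

lemma Lim.sub {P Q : ℕ → Pl m} {f g : E m → ℝ} (h : Lim P f) (h' : Lim Q g) :
    Lim (fun n => P n - Q n) (fun x => f x - g x) := by
  refine ⟨h.1.sub h'.1, fun x hx => ?_⟩
  simp only [map_sub]
  exact (h.2 x hx).sub (h'.2 x hx)

lemma Lim.sum {κ : Type} (s : Finset κ) {P : κ → ℕ → Pl m} {f : κ → E m → ℝ}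
    (h : ∀ k, Lim (P k) (f k)) : Lim (fun n => ∑ k ∈ s, P k n) (fun x => ∑ k ∈ s, f k x) := by
  refine ⟨Cau.sum s fun k => (h k).1, fun x hx => ?_⟩
  simp only [map_sum]
  exact tendsto_finsetSum _ fun k _ => (h k).2 x hx

lemma Lim.lap {P : ℕ → Pl m} {f : E m → ℝ} (h : Lim P f) :
    Lim (fun n => lapP (P n)) (lap f) := by
  simp only [lapP_apply]
  exact Lim.sum _ fun i => (h.pd i).pd i

end limits

end SVT

namespace SVT

open MvPolynomial Filter Topology

section assembly
variable {m : ℕ}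

lemma Cau.dot {f : ℕ → Fin m → Pl m} (h : ∀ j, Cau (fun n => f n j)) :
    Cau (fun n => dot (f n)) := Cau.sum _ fun j => (h j).mul _

lemma Cau.dv {f : ℕ → Fin m → Pl m} (h : ∀ j, Cau (fun n => f n j)) :
    Cau (fun n => dv (f n)) := Cau.sum _ fun j => (h j).pd j

lemma Cau.pF (hm : 2 ≤ m) {f : ℕ → Fin m → Pl m} (h : ∀ j, Cau (fun n => f n j)) :
    Cau (fun n => pF hm (f n)) := by
  have := Cau.J 0 ((Cau.dot h).add
    (Cau.Dir hm (((Cau.dv h).D.add ((Cau.dv h).mul 2)).sub (Cau.dot h).lap)))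
  rw [Nat.cast_zero] at this
  exact this

lemma Cau.gF (hm : 2 ≤ m) {f : ℕ → Fin m → Pl m} (h : ∀ j, Cau (fun n => f n j)) (j : Fin m) :
    Cau (fun n => gF hm (f n) j) := (h j).sub ((Cau.pF hm h).pd j)

lemma Cau.uF (hm : 2 ≤ m) {f : ℕ → Fin m → Pl m} (h : ∀ j, Cau (fun n => f n j)) :
    Cau (fun n => uF hm (f n)) := ((Cau.pF hm h).mul _).Dir hm

lemma Cau.wF (hm : 2 ≤ m) {g : ℕ → Fin m → Pl m} (h : ∀ j, Cau (fun n => g n j)) (j : Fin m) :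
    Cau (fun n => wF hm (g n) j) := by
  have hy : Cau (fun n => yF hm (g n) j) :=
    ((((h j).D.add ((h j).mul 3)).sub ((Cau.dot h).pd j)).mul 2).Dir hm
  have hs : Cau (fun n => sF hm (g n)) := ((Cau.dot h).mul 2).Dir hm
  have := (hy.add (hs.pd j)).J 1
  rw [Nat.cast_one] at this
  exact this

lemma Lim.zero_of {P : ℕ → Pl m} {f : E m → ℝ} (h : Lim P f) {x : E m} (hx : x ∈ Ball m)
    (h0 : ∀ n, ev x (P n) = 0) : f x = 0 := by
  have := h.2 x hx
  simp only [h0] at this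
  exact tendsto_nhds_unique this tendsto_const_nhds

theorem main_of_approx (hm : 2 ≤ m) (t : Fin m → Fin m → E m → ℝ)
    (P : Fin m → Fin m → ℕ → Pl m) (hP : ∀ i j, Lim (P i j) (t i j))
    (ht_symm : ∀ i j, ∀ x, t i j x = t j i x)
    (ht_trace : ∀ x, ∑ i, t i i x = 0) :
    ∃ (u : E m → ℝ) (w : Fin m → E m → ℝ) (T : Fin m → Fin m → E m → ℝ),
      ContDiffOn ℝ (⊤ : ℕ∞) u (Ball m) ∧
      (∀ i, ContDiffOn ℝ (⊤ : ℕ∞) (w i) (Ball m)) ∧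
      (∀ i j, ContDiffOn ℝ (⊤ : ℕ∞) (T i j) (Ball m)) ∧
      (∀ x ∈ Ball m, ∀ i j,
        t i j x = diam i j u x + (1/2) * (pd i (w j) x + pd j (w i) x) + T i j x) ∧
      (∀ x ∈ Sph m, u x = 0) ∧
      (∀ x ∈ Ball m, ∑ i, pd i (w i) x = 0) ∧
      (∀ x ∈ Sph m, ∑ k, w k x * x k = 0) ∧
      (∀ x ∈ Sph m, ∀ v : E m, (∑ k, v k * x k) = 0 →
        ∑ k, ∑ l, (pd k (w l) x - pd l (w k) x) * x k * v l = 0) ∧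
      (∀ x ∈ Ball m, ∀ i j, T i j x = T j i x) ∧
      (∀ x ∈ Ball m, ∑ i, T i i x = 0) ∧
      (∀ x ∈ Ball m, ∀ j, ∑ i, pd i (T i j) x = 0) := by
  let f : ℕ → Fin m → Pl m := fun n j => divT (fun i j => P i j n) j
  have hf : ∀ j, Cau (fun n => f n j) := fun j => Cau.sum _ fun i => (hP i j).1.pd i
  have hgC := Cau.gF hm hf
  obtain ⟨u, hu⟩ := (Cau.uF hm hf).exists_lim
  choose w hw using fun j => (Cau.wF hm (g := fun n => gF hm (f n)) hgC j).exists_lim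
  have hmain : ∀ n, _ := fun n =>
    wF_main hm (gF hm (f n)) (dv_gF hm (f n)) (dot_gF hm (f n)).choose (dot_gF hm (f n)).choose_spec
  let T : Fin m → Fin m → E m → ℝ := fun i j x =>
    t i j x - (diam i j u x + (1/2) * (pd i (w j) x + pd j (w i) x))
  have hT : ∀ i j, Lim (fun n => P i j n - stP (uF hm (f n)) (wF hm (gF hm (f n))) i j) (T i j) := by
    intro i j
    have := (hP i j).sub ((((hu.pd j).pd i).sub
      (hu.lap.mul (C ((if i = j then (1 : ℝ) else 0) / m)))).add
      ((((hw j).pd i).add ((hw i).pd j)).mul (C (1 / 2))))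
    simp only [ev_C] at this
    exact this
  have hdivw : ∀ x ∈ Ball m, ∑ i, pd i (w i) x = 0 := by
    intro x hx
    have := Lim.sum Finset.univ fun i => (hw i).pd i
    refine this.zero_of hx fun n => ?_
    have h := (hmain n).1
    rw [dv] at h
    rw [h, map_zero]
  refine ⟨u, w, T, hu.contDiffOn, fun i => (hw i).contDiffOn, fun i j => (hT i j).contDiffOn,
    fun x _ i j => by simp only [T]; ring, fun x hx => ?_, hdivw, fun x hx => ?_,
    fun x hx v _ => ?_, fun x hx i j => ?_, fun x hx => ?_, fun x hx j => ?_⟩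
  · exact hu.zero_of (Sph_sub hx) fun n => ev_Dir_Sph hm _ hx
  · have := Lim.sum Finset.univ fun i => (hw i).mul (X i)
    have h0 := this.zero_of (Sph_sub hx) fun n => by
      have h := (hmain n).2.2.1
      rw [dot] at h
      rw [h]; exact ev_Dir_Sph hm _ hx
    simp only [ev_X] at h0
    rw [← h0]
    exact Finset.sum_congr rfl fun i _ => mul_comm _ _
  · rw [Finset.sum_comm]
    refine Finset.sum_eq_zero fun l _ => ?_
    have := Lim.sum Finset.univ fun k => (((hw l).pd k).sub ((hw k).pd l)).mul (X k)
    have h0 := this.zero_of (Sph_sub hx) fun n => by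
      rw [(hmain n).2.2.2 l]; exact ev_Dir_Sph hm _ hx
    simp only [ev_X] at h0
    rw [← Finset.sum_mul]
    simp only [mul_comm _ (x.ofLp _)]
    rw [h0, zero_mul]
  · simp only [T, diam]
    have h1 : pd i (pd j u) x = pd j (pd i u) x := by
      refine Lim.unique ((hu.pd j).pd i) ?_ x hx
      simp only [pd_comm i j]
      exact (hu.pd i).pd j
    have h2 : (if i = j then (1 : ℝ) else 0) = if j = i then 1 else 0 := by
      by_cases h : i = j
      · subst h; rfl
      · rw [if_neg h, if_neg (Ne.symm h)]
    rw [ht_symm i j x, h1, h2]; ring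
  · simp only [T, diam]
    have hm0 : (m : ℝ) ≠ 0 := by
      have : 0 < m := by omega
      positivity
    simp only [Finset.sum_sub_distrib, Finset.sum_add_distrib, ht_trace, ← Finset.mul_sum,
      hdivw x hx]
    simp only [if_true, Finset.sum_const, Finset.card_univ, Fintype.card_fin, nsmul_eq_mul, lap]
    field_simp
    ring
  · have := Lim.sum Finset.univ fun i => (hT i j).pd i
    refine this.zero_of hx fun n => ?_
    have h := solution_div hm (f n) j
    have h2 : f n j = ∑ i, pderiv i (P i j n) := rfl
    rw [h2, divT] at h
    have e : ∑ k, pderiv k (P k j n - stP (uF hm (f n)) (wF hm (gF hm (f n))) k j) = 0 := by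
      simp only [map_sub, Finset.sum_sub_distrib, h, sub_self]
    rw [e, map_zero]

end assembly

end SVT

namespace SVT

open MvPolynomial Filter Topology MeasureTheory

section approximation
variable {m : ℕ}

/-- Convolution of a polynomial with a function. -/
def cvl (p : Pl m) (F : E m → ℝ) : E m → ℝ :=
  convolution (fun y => ev y p) F (ContinuousLinearMap.mul ℝ ℝ) volume

lemma cvl_apply (p : Pl m) (F : E m → ℝ) (x : E m) :
    cvl p F x = ∫ t, ev t p * F (x - t) := rfl

lemma cvl_apply' (p : Pl m) (F : E m → ℝ) (x : E m) :
    cvl p F x = ∫ y, ev (x - y) p * F y := by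
  rw [cvl_apply, ← integral_sub_left_eq_self _ volume x]
  simp

lemma cvl_poly (p : Pl m) : ∀ (F : E m → ℝ), Continuous F → HasCompactSupport F →
    ∃ P : Pl m, ∀ x, ev x P = cvl p F x := by
  have hInteg : ∀ (q : Pl m) (F : E m → ℝ), Continuous F → HasCompactSupport F → ∀ x : E m,
      Integrable (fun y => ev (x - y) q * F y) := by
    intro q F hF hc x
    refine Continuous.integrable_of_hasCompactSupport ?_ hc.mul_left
    exact ((continuous_ev q).comp (continuous_const.sub continuous_id)).mul hF
  induction p using MvPolynomial.induction_on with
  | C a =>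
    intro F hF hc
    refine ⟨C (a * ∫ y, F y), fun x => ?_⟩
    rw [cvl_apply', ev_C]
    simp only [ev_C]
    rw [integral_const_mul]
  | add p q hp hq =>
    intro F hF hc
    obtain ⟨P, hP⟩ := hp F hF hc
    obtain ⟨Q, hQ⟩ := hq F hF hc
    refine ⟨P + Q, fun x => ?_⟩
    rw [map_add, hP, hQ, cvl_apply', cvl_apply', cvl_apply',
      ← integral_add (hInteg p F hF hc x) (hInteg q F hF hc x)]
    simp only [map_add, add_mul]
  | mul_X p i hp =>
    intro F hF hc
    have hci : Continuous (fun y : E m => y i) := (EuclideanSpace.proj i : E m →L[ℝ] ℝ).continuous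
    have hF' : Continuous (fun y : E m => y i * F y) := hci.mul hF
    have hc' : HasCompactSupport (fun y : E m => y i * F y) := hc.mul_left
    obtain ⟨P, hP⟩ := hp F hF hc
    obtain ⟨Q, hQ⟩ := hp _ hF' hc'
    refine ⟨X i * P - Q, fun x => ?_⟩
    rw [map_sub, map_mul, ev_X, hP, hQ, cvl_apply', cvl_apply', cvl_apply',
      ← integral_const_mul, ← integral_sub ((hInteg p F hF hc x).const_mul _) (hInteg p _ hF' hc' x)]
    refine integral_congr_ae (Eventually.of_forall fun y => ?_)
    simp only [map_mul, ev_X, PiLp.sub_apply]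
    ring

/-- Smooth functions supported in a fixed ball. -/
def Good (R : ℝ) (F : E m → ℝ) : Prop :=
  ContDiff ℝ (⊤ : ℕ∞) F ∧ tsupport F ⊆ Metric.closedBall 0 R

lemma Good.compact {R : ℝ} {F : E m → ℝ} (h : Good R F) : HasCompactSupport F :=
  (isCompact_closedBall (0 : E m) R).of_isClosed_subset (isClosed_tsupport _) h.2

/-- Partial derivative on the whole space. -/
def dF (i : Fin m) (F : E m → ℝ) : E m → ℝ := fun x => fderiv ℝ F x (EuclideanSpace.single i 1)

lemma Good.dF {R : ℝ} {F : E m → ℝ} (h : Good R F) (i : Fin m) : Good R (dF i F) := by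
  refine ⟨?_, (tsupport_fderiv_apply_subset ℝ _).trans h.2⟩
  have : ContDiff ℝ (⊤ : ℕ∞) (fderiv ℝ F) := h.1.fderiv_right (by simp)
  exact this.clm_apply contDiff_const

/-- The approximating polynomial. -/
def ap {R : ℝ} (p : Pl m) {F : E m → ℝ} (h : Good R F) : Pl m :=
  (cvl_poly p F h.1.continuous h.compact).choose

lemma ev_ap {R : ℝ} (p : Pl m) {F : E m → ℝ} (h : Good R F) (x : E m) :
    ev x (ap p h) = cvl p F x := (cvl_poly p F h.1.continuous h.compact).choose_spec x

lemma cvl_deriv {R : ℝ} (p : Pl m) {F : E m → ℝ} (h : Good R F) (x : E m) :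
    ∃ A : E m →L[ℝ] ℝ, HasFDerivAt (cvl p F) A x ∧
      ∀ i, A (EuclideanSpace.single i 1) = cvl p (dF i F) x := by
  have hl : LocallyIntegrable (fun y : E m => ev y p) volume := (continuous_ev p).locallyIntegrable
  have h1F : ContDiff ℝ 1 F := h.1.of_le (by simp)
  refine ⟨_, h.compact.hasFDerivAt_convolution_right (ContinuousLinearMap.mul ℝ ℝ) hl h1F x, ?_⟩
  intro i
  exact convolution_precompR_apply (ContinuousLinearMap.mul ℝ ℝ) hl (h.compact.fderiv ℝ)
    (h1F.continuous_fderiv one_ne_zero) x _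

lemma dev_single (P : Pl m) (x : E m) (i : Fin m) :
    dev P x (EuclideanSpace.single i 1) = ev x (pderiv i P) := by
  rw [dev_apply]; simp

lemma pd_ap2 {R : ℝ} (p : Pl m) {F : E m → ℝ} (h : Good R F) (i : Fin m) (x : E m) :
    ev x (pderiv i (ap p h)) = cvl p (dF i F) x := by
  obtain ⟨A, hA, hA'⟩ := cvl_deriv p h x
  have h2 := hasFDerivAt_ev (ap p h) x
  have h3 : HasFDerivAt (fun y => ev y (ap p h)) A x :=
    hA.congr_of_eventuallyEq (Eventually.of_forall fun y => ev_ap p h y)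
  have h4 : dev (ap p h) x = A := h2.unique h3
  rw [← hA' i, ← h4]
  exact (dev_single _ _ _).symm

lemma pd_ap {R : ℝ} (p : Pl m) {F : E m → ℝ} (h : Good R F) (i : Fin m) :
    pderiv i (ap p h) = ap p (h.dF i) := by
  rw [← sub_eq_zero]
  apply eq_zero_of_Ball
  intro x _
  rw [map_sub, ev_ap, pd_ap2, sub_self]

/-- Unnormalised kernel. -/
def kr (m : ℕ) (R : ℝ) : Pl m := 1 - C (1 / R ^ 2) * ∑ i, X i * X i

lemma ev_kr (R : ℝ) (x : E m) : ev x (kr m R) = 1 - ‖x‖ ^ 2 / R ^ 2 := by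
  rw [kr, map_sub, map_mul, ev_rsq, ev_C, map_one]; ring

/-- Mass of the kernel. -/
def mass (m : ℕ) (R : ℝ) (n : ℕ) : ℝ := ∫ z in Metric.closedBall (0 : E m) R, ev z (kr m R) ^ n

/-- Normalised kernel. -/
def kn (m : ℕ) (R : ℝ) (n : ℕ) : Pl m := C ((mass m R n)⁻¹) * kr m R ^ n

lemma kr_nonneg {R : ℝ} (hR : 0 < R) {x : E m} (hx : x ∈ Metric.closedBall (0 : E m) R) :
    0 ≤ ev x (kr m R) := by
  rw [ev_kr, sub_nonneg, div_le_one (by positivity)]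
  have : ‖x‖ ≤ R := by simpa using hx
  exact pow_le_pow_left₀ (norm_nonneg _) this 2

lemma mass_pos {R : ℝ} (hR : 0 < R) (n : ℕ) : 0 < mass m R n := by
  unfold mass
  rw [setIntegral_pos_iff_support_of_nonneg_ae]
  · refine lt_of_lt_of_le (Metric.measure_ball_pos volume (0 : E m) hR) (measure_mono ?_)
    intro z hz
    have hz' : ‖z‖ < R := by simpa using hz
    refine ⟨?_, Metric.ball_subset_closedBall hz⟩
    have : 0 < ev z (kr m R) := by
      rw [ev_kr, sub_pos, div_lt_one (by positivity)]
      exact pow_lt_pow_left₀ hz' (norm_nonneg _) two_ne_zero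
    exact (pow_pos this n).ne'
  · rw [EventuallyLE, ae_restrict_iff' measurableSet_closedBall]
    exact Eventually.of_forall fun z hz => pow_nonneg (kr_nonneg hR hz) n
  · exact ((continuous_ev _).pow n).continuousOn.integrableOn_compact (isCompact_closedBall _ _)

lemma moment {R : ℝ} (hR : 0 < R) :
    Tendsto (fun n => ∫ z in Metric.closedBall (0 : E m) R, ev z (kn m R n) * ‖z‖) atTop (𝓝 0) := by
  have h := tendsto_setIntegral_pow_smul_of_unique_maximum_of_isCompact_of_continuousOn
    (μ := (volume : Measure (E m))) (isCompact_closedBall (0 : E m) R)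
    (c := fun z => ev z (kr m R)) (x₀ := 0) (g := fun z => ‖z‖)
    (continuous_ev _).continuousOn (fun y _ hy => by
      rw [ev_kr, ev_kr]
      have : 0 < ‖y‖ ^ 2 / R ^ 2 := by
        have := norm_pos_iff.2 hy
        positivity
      simpa using this) (fun x hx => kr_nonneg hR hx) (by rw [ev_kr]; simp)
      (by
        rw [interior_closedBall _ hR.ne']
        exact subset_closure (by simpa using hR)) continuous_norm.continuousOn
  rw [norm_zero] at h
  refine h.congr fun n => ?_
  rw [smul_eq_mul, ← integral_const_mul]
  refine integral_congr_ae (Eventually.of_forall fun z => ?_)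
  simp only [kn, map_mul, ev_C, map_pow, smul_eq_mul, mass]
  ring

lemma ap_error {R : ℝ} (hR : 0 < R) {F : E m → ℝ} (h : Good R F) :
    ∃ K : ℝ, 0 ≤ K ∧ ∀ n, ∀ x ∈ Ball m, |ev x (ap (kn m (R + 1) n) h) - F x| ≤
      K * ∫ z in Metric.closedBall (0 : E m) (R + 1), ev z (kn m (R + 1) n) * ‖z‖ := by
  obtain ⟨K, hK⟩ := ContDiff.lipschitzWith_of_hasCompactSupport h.compact h.1 (by simp)
  refine ⟨K, K.2, fun n x hx => ?_⟩
  have hR1 : 0 < R + 1 := by linarith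
  set B := Metric.closedBall (0 : E m) (R + 1) with hB
  have hBc : IsCompact B := isCompact_closedBall _ _
  set k : E m → ℝ := fun z => ev z (kn m (R + 1) n) with hk
  have hkc : Continuous k := continuous_ev _
  have hk0 : ∀ z ∈ B, 0 ≤ k z := by
    intro z hz
    simp only [hk, kn, map_mul, ev_C, map_pow]
    have := mass_pos (m := m) hR1 n
    have := kr_nonneg hR1 hz
    positivity
  have hk1 : ∫ z in B, k z = 1 := by
    simp only [hk, kn, map_mul, ev_C, map_pow]
    rw [integral_const_mul]
    exact inv_mul_cancel₀ (mass_pos hR1 n).ne'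
  have h1 : cvl (kn m (R + 1) n) F x = ∫ z in B, k z * F (x - z) := by
    rw [cvl_apply, setIntegral_eq_integral_of_forall_compl_eq_zero]
    intro z hz
    have : F (x - z) = 0 := by
      by_contra hne
      have h2 := h.2 (subset_tsupport _ hne)
      apply hz
      rw [hB]
      simp only [Metric.mem_closedBall, dist_zero_right] at h2 ⊢
      have h3 := mem_Ball.1 hx
      have h4 : ‖z‖ ≤ ‖x‖ + ‖x - z‖ := by
        have := norm_sub_le x (x - z)
        simpa using this
      linarith
    rw [this, mul_zero]
  have hFc := h.1.continuous
  have i1 : IntegrableOn (fun z => k z * F (x - z)) B :=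
    (hkc.mul (hFc.comp (continuous_const.sub continuous_id))).continuousOn.integrableOn_compact hBc
  have i2 : IntegrableOn (fun z => k z * F x) B :=
    (hkc.mul continuous_const).continuousOn.integrableOn_compact hBc
  have i3 : IntegrableOn (fun z => K * (k z * ‖z‖)) B :=
    (continuous_const.mul (hkc.mul continuous_norm)).continuousOn.integrableOn_compact hBc
  have h2 : F x = ∫ z in B, k z * F x := by
    rw [integral_mul_const, hk1, one_mul]
  rw [ev_ap, h1]
  conv_lhs => rw [h2]
  rw [← integral_sub i1 i2, ← integral_const_mul, ← Real.norm_eq_abs]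
  refine norm_integral_le_of_norm_le i3 ?_
  rw [ae_restrict_iff' hBc.measurableSet]
  refine Eventually.of_forall fun z hz => ?_
  rw [← mul_sub, norm_mul, Real.norm_of_nonneg (hk0 z hz)]
  have := hK.dist_le_mul (x - z) x
  rw [dist_eq_norm, dist_eq_norm] at this
  have e : ‖x - z - x‖ = ‖z‖ := by rw [sub_sub_cancel_left, norm_neg]
  rw [e] at this
  calc _ ≤ k z * (K * ‖z‖) := mul_le_mul_of_nonneg_left this (hk0 z hz)
    _ = _ := by ring

lemma ap_word {R : ℝ} (hR : 0 < R) (w : List (Fin m)) {F : E m → ℝ} (h : Good R F) :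
    ∃ G : E m → ℝ, ∀ ε > 0, ∀ᶠ n in atTop, ∀ x ∈ Ball m,
      |ev x (dw w (ap (kn m (R + 1) n) h)) - G x| ≤ ε := by
  induction w generalizing F with
  | nil =>
    refine ⟨F, fun ε hε => ?_⟩
    obtain ⟨K, hK0, hK⟩ := ap_error hR h
    have h1 := (moment (m := m) (R := R + 1) (by linarith)).const_mul K
    rw [mul_zero] at h1
    filter_upwards [h1.eventually_le_const hε] with n hn x hx
    exact (hK n x hx).trans hn
  | cons i w ih =>
    obtain ⟨G, hG⟩ := ih (h.dF i)
    refine ⟨G, fun ε hε => ?_⟩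
    simp only [dw_cons, pd_ap]
    exact hG ε hε

lemma Good.lim {R : ℝ} (hR : 0 < R) {F : E m → ℝ} (h : Good R F) :
    Lim (fun n => ap (kn m (R + 1) n) h) F := by
  constructor
  · intro w ε hε
    obtain ⟨G, hG⟩ := ap_word hR w h
    have h1 := hG (ε / 2) (by positivity)
    have h2 := h1.prod_mk h1
    filter_upwards [h2] with nk hnk x hx
    rw [map_sub, map_sub]
    have a := hnk.1 x hx
    have b := hnk.2 x hx
    rw [abs_le] at a b ⊢
    constructor <;> linarith [a.1, a.2, b.1, b.2]
  · intro x hx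
    obtain ⟨K, hK0, hK⟩ := ap_error hR h
    have h1 := (moment (m := m) (R := R + 1) (by linarith)).const_mul K
    rw [mul_zero] at h1
    rw [tendsto_iff_norm_sub_tendsto_zero]
    exact squeeze_zero (fun _ => norm_nonneg _) (fun n => hK n x hx) h1

lemma exists_approx {f : E m → ℝ} {U : Set (E m)} (hU : IsOpen U) (hB : Ball m ⊆ U)
    (hf : ContDiffOn ℝ (⊤ : ℕ∞) f U) : ∃ P : ℕ → Pl m, Lim P f := by
  obtain ⟨δ, hδ, hδU⟩ := (isCompact_Ball (m := m)).exists_cthickening_subset_open hU hB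
  rw [Ball, cthickening_closedBall hδ.le zero_le_one] at hδU
  let b : ContDiffBump (0 : E m) := ⟨1, δ + 1, one_pos, by linarith⟩
  have hts : tsupport (fun x => b x * f x) ⊆ Metric.closedBall 0 (δ + 1) := by
    refine (tsupport_mul_subset_left (f := b) (g := f)).trans ?_
    rw [b.tsupport_eq]
  have hg : Good (δ + 1) (fun x => b x * f x) := by
    refine ⟨contDiff_iff_contDiffAt.2 fun x => ?_, hts⟩
    by_cases hx : x ∈ tsupport (fun x => b x * f x)
    swap
    · exact contDiffAt_const.congr_of_eventuallyEq (notMem_tsupport_iff_eventuallyEq.1 hx)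
    exact b.contDiff.contDiffAt.mul (hf.contDiffAt (hU.mem_nhds (hδU (hts hx))))
  have := hg.lim (by linarith)
  refine ⟨_, this.1, fun x hx => ?_⟩
  have h2 := this.2 x hx
  have e : b x = 1 := b.one_of_mem_closedBall hx
  simp only [e, one_mul] at h2
  exact h2

end approximation

end SVT

theorem svt_decomposition_on_ball
    (m : ℕ) (hm : 2 ≤ m)
    (t : Fin m → Fin m → E m → ℝ)
    (ht_smooth : ∃ U : Set (E m), IsOpen U ∧ Ball m ⊆ U ∧
      ∀ i j, ContDiffOn ℝ (⊤ : ℕ∞) (t i j) U)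
    (ht_symm : ∀ i j, ∀ x, t i j x = t j i x)
    (ht_trace : ∀ x, ∑ i, t i i x = 0) :
    ∃ (u : E m → ℝ) (w : Fin m → E m → ℝ) (T : Fin m → Fin m → E m → ℝ),
      -- smoothness up to the boundary
      ContDiffOn ℝ (⊤ : ℕ∞) u (Ball m) ∧
      (∀ i, ContDiffOn ℝ (⊤ : ℕ∞) (w i) (Ball m)) ∧
      (∀ i j, ContDiffOn ℝ (⊤ : ℕ∞) (T i j) (Ball m)) ∧
      -- the decomposition  t_ij = ◇_ij u + ½(∂_i w_j + ∂_j w_i) + T_ij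
      (∀ x ∈ Ball m, ∀ i j,
        t i j x = diam i j u x + (1/2) * (pd i (w j) x + pd j (w i) x) + T i j x) ∧
      -- (i)  u vanishes on the boundary sphere
      (∀ x ∈ Sph m, u x = 0) ∧
      -- (ii)  div w = 0 on B̄
      (∀ x ∈ Ball m, ∑ i, pd i (w i) x = 0) ∧
      -- (iii)  w is tangential on the boundary: ∑ₖ wₖ(x) xₖ = 0 on S
      (∀ x ∈ Sph m, ∑ k, w k x * x k = 0) ∧
      -- (iv)  normal-tangential part of dw vanishes on the boundary
      (∀ x ∈ Sph m, ∀ v : E m, (∑ k, v k * x k) = 0 →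
        ∑ k, ∑ l, (pd k (w l) x - pd l (w k) x) * x k * v l = 0) ∧
      -- (v)  T is symmetric, traceless and transverse on B̄
      (∀ x ∈ Ball m, ∀ i j, T i j x = T j i x) ∧
      (∀ x ∈ Ball m, ∑ i, T i i x = 0) ∧
      (∀ x ∈ Ball m, ∀ j, ∑ i, pd i (T i j) x = 0) := by
  obtain ⟨U, hU, hB, ht⟩ := ht_smooth
  choose P hP using fun i j => SVT.exists_approx hU hB (ht i j)
  exact SVT.main_of_approx hm t P hP ht_symm ht_trace

end
end

section
/- Let m ≥ 2. Suppose u is a function, w a vector field, and T a rank-2 tensor field, all smooth on the closed unit ball B̄ ⊂ ℝ^m, satisfying: u(x) = 0 for x ∈ S; div w = 0 on B̄; ∑_k w_k(x) x_k = 0 for x ∈ S; ∑_{k,l} (∂_k w_l − ∂_l w_k)(x) x_k v_l = 0 for every x ∈ S and every v with ⟨v,x⟩ = 0; T is symmetric with ∑_i T_ii = 0 and ∑_i ∂_i T_ij = 0 on B̄. If ◇_ij u + ½(∂_i w_j + ∂_j w_i) + T_ij = 0 at every point of B̄ and all i,j, then w = 0 on B̄, T = 0 on B̄, and ◇_ij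 u = 0 on B̄ for all i,j. In particular the three summands in the decomposition t = ◇u + ½(∂w + (∂w)ᵀ) + T subject to these side conditions are uniquely determined by t. (Uniqueness part of the paper's Theorem 3.1, specialized to the flat ball.) -/
/-!
STATEMENT 1: Uniqueness part of the scalar–vector–tensor decomposition theorem
for symmetric rank-2 tensors (paper's Theorem 3.1) on the closed unit ball.
-/

noncomputable section

open MeasureTheory Filter Topology

/-- Smoothness on the closed ball. -/
abbrev Sm {m : ℕ} (f : E m → ℝ) : Prop := ContDiffOn ℝ (⊤ : ℕ∞) f (Ball m)

lemma ball_convex (m : ℕ) : Convex ℝ (Ball m) := convex_closedBall _ _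

lemma ball_interior (m : ℕ) : interior (Ball m) = Metric.ball 0 1 :=
  interior_closedBall _ one_ne_zero

lemma ball_closure (m : ℕ) : closure (Metric.ball (0 : E m) 1) = Ball m :=
  closure_ball _ one_ne_zero

lemma ball_ud (m : ℕ) : UniqueDiffOn ℝ (Ball m) :=
  uniqueDiffOn_convex (ball_convex m) (by rw [ball_interior]; exact ⟨0, by simp⟩)

lemma Sm.diff {m : ℕ} {f : E m → ℝ} (hf : Sm f) : DifferentiableOn ℝ f (Ball m) :=
  hf.differentiableOn (by simp)

lemma Sm.pd {m : ℕ} {f : E m → ℝ} (hf : Sm f) (i : Fin m) : Sm (pd i f) := by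
  have h : ContDiffOn ℝ (⊤ : ℕ∞) (fderivWithin ℝ f (Ball m)) (Ball m) :=
    hf.fderivWithin (ball_ud m) (by simp)
  exact h.clm_apply contDiffOn_const

lemma sm_coord {m : ℕ} (i : Fin m) : Sm (fun x : E m => x i) :=
  (EuclideanSpace.proj (𝕜 := ℝ) i : E m →L[ℝ] ℝ).contDiff.contDiffOn

lemma sm_sum {m : ℕ} {f : Fin m → E m → ℝ} (hf : ∀ i, Sm (f i)) : Sm (fun x => ∑ i, f i x) :=
  ContDiffOn.sum fun i _ => hf i

lemma Sm.mul' {m : ℕ} {f g : E m → ℝ} (hf : Sm f) (hg : Sm g) : Sm (fun x => f x * g x) :=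
  ContDiffOn.mul hf hg

lemma sm_const {m : ℕ} (c : ℝ) : Sm (fun _ : E m => c) := contDiffOn_const

lemma Sm.cmul {m : ℕ} {f : E m → ℝ} (c : ℝ) (hf : Sm f) : Sm (fun x => c * f x) :=
  (sm_const c).mul' hf

lemma Sm.add' {m : ℕ} {f g : E m → ℝ} (hf : Sm f) (hg : Sm g) : Sm (fun x => f x + g x) :=
  ContDiffOn.add hf hg

lemma Sm.sub' {m : ℕ} {f g : E m → ℝ} (hf : Sm f) (hg : Sm g) : Sm (fun x => f x - g x) :=
  ContDiffOn.sub hf hg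

lemma Sm.lap {m : ℕ} {f : E m → ℝ} (hf : Sm f) : Sm (lap f) :=
  sm_sum fun i => (hf.pd i).pd i

lemma pd_congr {m : ℕ} {f g : E m → ℝ} (h : ∀ x ∈ Ball m, f x = g x) (i : Fin m)
    {x : E m} (hx : x ∈ Ball m) : pd i f x = pd i g x := by
  unfold pd
  rw [fderivWithin_congr h (h x hx)]

lemma pd_add {m : ℕ} {f g : E m → ℝ} (hf : Sm f) (hg : Sm g) (i : Fin m)
    {x : E m} (hx : x ∈ Ball m) : pd i (fun y => f y + g y) x = pd i f x + pd i g x := by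
  unfold pd
  rw [fderivWithin_fun_add (ball_ud m x hx) (hf.diff x hx) (hg.diff x hx)]; rfl

lemma pd_sub {m : ℕ} {f g : E m → ℝ} (hf : Sm f) (hg : Sm g) (i : Fin m)
    {x : E m} (hx : x ∈ Ball m) : pd i (fun y => f y - g y) x = pd i f x - pd i g x := by
  unfold pd
  rw [fderivWithin_fun_sub (ball_ud m x hx) (hf.diff x hx) (hg.diff x hx)]; rfl

lemma pd_mul {m : ℕ} {f g : E m → ℝ} (hf : Sm f) (hg : Sm g) (i : Fin m)
    {x : E m} (hx : x ∈ Ball m) :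
    pd i (fun y => f y * g y) x = pd i f x * g x + f x * pd i g x := by
  unfold pd
  rw [fderivWithin_fun_mul (ball_ud m x hx) (hf.diff x hx) (hg.diff x hx)]
  simp; ring

lemma pd_const {m : ℕ} (c : ℝ) (i : Fin m) (x : E m) : pd i (fun _ : E m => c) x = 0 := by
  unfold pd; simp

lemma pd_cmul {m : ℕ} {f : E m → ℝ} (c : ℝ) (hf : Sm f) (i : Fin m)
    {x : E m} (hx : x ∈ Ball m) : pd i (fun y => c * f y) x = c * pd i f x := by
  rw [pd_mul (sm_const c) hf i hx, pd_const]; ring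

lemma pd_sum {m : ℕ} {f : Fin m → E m → ℝ} (hf : ∀ k, Sm (f k)) (i : Fin m)
    {x : E m} (hx : x ∈ Ball m) : pd i (fun y => ∑ k, f k y) x = ∑ k, pd i (f k) x := by
  unfold pd
  rw [fderivWithin_fun_sum (ball_ud m x hx) (fun k _ => (hf k).diff x hx)]
  simp

lemma pd_coord {m : ℕ} (k i : Fin m) {x : E m} (hx : x ∈ Ball m) :
    pd i (fun y : E m => y k) x = if i = k then 1 else 0 := by
  unfold pd
  have : HasFDerivWithinAt (fun y : E m => y k)
      (EuclideanSpace.proj (𝕜 := ℝ) k : E m →L[ℝ] ℝ) (Ball m) x :=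
    (EuclideanSpace.proj (𝕜 := ℝ) k : E m →L[ℝ] ℝ).hasFDerivWithinAt
  rw [this.fderivWithin (ball_ud m x hx)]
  simp [eq_comm]

lemma pd_comm {m : ℕ} {f : E m → ℝ} (hf : Sm f) (i j : Fin m) {x : E m} (hx : x ∈ Ball m) :
    pd i (pd j f) x = pd j (pd i f) x := by
  have h : ContDiffOn ℝ (⊤ : ℕ∞) (fderivWithin ℝ f (Ball m)) (Ball m) :=
    hf.fderivWithin (ball_ud m) (by simp)
  have hd : DifferentiableWithinAt ℝ (fderivWithin ℝ f (Ball m)) (Ball m) x :=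
    h.differentiableOn (by simp) x hx
  have key : ∀ i j : Fin m, pd i (pd j f) x =
      fderivWithin ℝ (fderivWithin ℝ f (Ball m)) (Ball m) x (EuclideanSpace.single i 1)
        (EuclideanSpace.single j 1) := by
    intro i j
    have := (hd.hasFDerivWithinAt.clm_apply
      (hasFDerivWithinAt_const (EuclideanSpace.single j (1:ℝ)) x (Ball m))).fderivWithin
      (ball_ud m x hx)
    change fderivWithin ℝ (fun y => fderivWithin ℝ f (Ball m) y (EuclideanSpace.single j 1))
      (Ball m) x (EuclideanSpace.single i 1) = _
    rw [this]; simp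
  rw [key, key]
  have hs : IsSymmSndFDerivWithinAt ℝ f (Ball m) x :=
    (hf x hx).isSymmSndFDerivWithinAt (by simp only [minSmoothness_of_isRCLikeNormedField]; exact WithTop.coe_le_coe.2 (le_top : (2:ℕ∞) ≤ ⊤)) (ball_ud m)
      (by rw [ball_interior, ball_closure]; exact hx) hx
  exact hs _ _

lemma fderivWithin_eq_sum {m : ℕ} (f : E m → ℝ) (x v : E m) :
    fderivWithin ℝ f (Ball m) x v = ∑ k, v k * pd k f x := by
  have hv : v = ∑ k, v k • (EuclideanSpace.single k (1:ℝ) : E m) := by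
    ext j; simp [Finset.sum_apply, Pi.single_apply]
  conv_lhs => rw [hv]
  simp [map_sum, pd]

lemma const_of_pd_zero {m : ℕ} {f : E m → ℝ} (hf : Sm f)
    (h : ∀ i, ∀ x ∈ Ball m, pd i f x = 0) {x y : E m} (hx : x ∈ Ball m) (hy : y ∈ Ball m) :
    f x = f y := by
  refine (ball_convex m).is_const_of_fderivWithin_eq_zero (𝕜 := ℝ) hf.diff ?_ hx hy
  intro z hz
  ext v
  rw [fderivWithin_eq_sum]
  simp [h _ z hz]

/-- The defining function `1 - |x|^2`. -/
def sfun {m : ℕ} (x : E m) : ℝ := 1 - ‖x‖ ^ 2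

lemma sfun_nonneg {m : ℕ} {x : E m} (hx : x ∈ Ball m) : 0 ≤ sfun x := by
  have : ‖x‖ ≤ 1 := by simpa [Ball] using hx
  unfold sfun; nlinarith [norm_nonneg x]

lemma sfun_pos {m : ℕ} {x : E m} (hx : ‖x‖ < 1) : 0 < sfun x := by
  unfold sfun; nlinarith [norm_nonneg x]

lemma sfun_le_one {m : ℕ} (x : E m) : sfun x ≤ 1 := by
  unfold sfun; nlinarith [norm_nonneg x]

lemma sfun_cont {m : ℕ} : Continuous (sfun (m := m)) := by
  unfold sfun; fun_prop

lemma sfun_hasFDerivAt {m : ℕ} (x : E m) :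
    HasFDerivAt (sfun (m := m)) (-(2 • innerSL ℝ x)) x := by
  have := (hasStrictFDerivAt_norm_sq x).hasFDerivAt.const_sub 1
  exact this

lemma mem_ball_iff {m : ℕ} (x : E m) : x ∈ Ball m ↔ ‖x‖ ≤ 1 := by simp [Ball]

/-- integral over the ball of `∂_i (η X)` vanishes, with `η = (s/(s+ε))^2`. -/
lemma int_cutoff {m : ℕ} {X : E m → ℝ} (hX : Sm X) (i : Fin m) {ε : ℝ} (hε : 0 < ε) :
    IntegrableOn (fun x => (sfun x / (sfun x + ε)) ^ 2 * pd i X x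
        - 4 * sfun x * ε / (sfun x + ε) ^ 3 * (x i * X x)) (Metric.ball 0 1) volume ∧
    ∫ x in Metric.ball (0 : E m) 1, ((sfun x / (sfun x + ε)) ^ 2 * pd i X x
        - 4 * sfun x * ε / (sfun x + ε) ^ 3 * (x i * X x)) = 0 := by
  set D : E m → ℝ := fun x => (sfun x / (sfun x + ε)) ^ 2 * pd i X x
        - 4 * sfun x * ε / (sfun x + ε) ^ 3 * (x i * X x) with hD
  set f : E m → ℝ := fun x => (sfun x / (sfun x + ε)) ^ 2 * X x with hf
  have hcomp : IsCompact (Ball m) := isCompact_closedBall _ _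
  have hne : ∀ x ∈ Ball m, sfun x + ε ≠ 0 := fun x hx => by
    have := sfun_nonneg hx; positivity
  have hsc : ContinuousOn (sfun (m := m)) (Ball m) := sfun_cont.continuousOn
  have hη : ContinuousOn (fun x : E m => (sfun x / (sfun x + ε)) ^ 2) (Ball m) :=
    (hsc.div (hsc.add continuousOn_const) hne).pow 2
  have hDc : ContinuousOn D (Ball m) := by
    refine (hη.mul (hX.pd i).continuousOn).sub (ContinuousOn.mul ?_
      ((sm_coord i).continuousOn.mul hX.continuousOn))
    exact ((continuousOn_const.mul hsc).mul continuousOn_const).div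
      ((hsc.add continuousOn_const).pow 3) (fun x hx => pow_ne_zero _ (hne x hx))
  have hfc : ContinuousOn f (Ball m) := hη.mul hX.continuousOn
  have hsub : Metric.ball (0 : E m) 1 ⊆ Ball m := Metric.ball_subset_closedBall
  have hDi : IntegrableOn D (Metric.ball 0 1) volume :=
    (hDc.integrableOn_compact hcomp).mono_set hsub
  have hfi : IntegrableOn f (Metric.ball 0 1) volume :=
    (hfc.integrableOn_compact hcomp).mono_set hsub
  refine ⟨hDi, ?_⟩
  have hmeas : MeasurableSet (Metric.ball (0 : E m) 1) := Metric.isOpen_ball.measurableSet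
  rw [← integral_indicator hmeas]
  have hDi' := hDi.integrable_indicator hmeas
  have hfi' := hfi.integrable_indicator hmeas
  obtain ⟨M, hM⟩ := hcomp.exists_bound_of_continuousOn hX.continuousOn
  have hM0 : 0 ≤ M := (norm_nonneg _).trans (hM 0 (by simp [Ball]))
  have hline : ∀ x, HasLineDerivAt ℝ ((Metric.ball (0 : E m) 1).indicator f)
      ((Metric.ball (0 : E m) 1).indicator D x) x (EuclideanSpace.single i 1) := by
    intro x
    by_cases hx : x ∈ Metric.ball (0 : E m) 1
    · have hxB := hsub hx
      have hnhds : Ball m ∈ 𝓝 x := Filter.mem_of_superset (Metric.isOpen_ball.mem_nhds hx) hsub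
      have hXd : HasFDerivAt X (fderivWithin ℝ X (Ball m) x) x :=
        (hX.diff x hxB).hasFDerivWithinAt.hasFDerivAt hnhds
      have hs := sfun_hasFDerivAt x
      have hq : HasDerivAt (fun s : ℝ => (s / (s + ε)) ^ 2)
          (2 * sfun x * ε / (sfun x + ε) ^ 3) (sfun x) := by
        have h1 := (((hasDerivAt_id (sfun x)).div ((hasDerivAt_id (sfun x)).add_const ε)
          (hne x hxB)).pow 2)
        convert! h1 using 1
        have := hne x hxB
        simp
        field_simp
      have hη' := hq.comp_hasFDerivAt x hs
      have hfd := hη'.mul hXd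
      have hev : (Metric.ball (0 : E m) 1).indicator f =ᶠ[𝓝 x] f := by
        filter_upwards [Metric.isOpen_ball.mem_nhds hx] with y hy
        exact Set.indicator_of_mem hy f
      have hfin := (hfd.congr_of_eventuallyEq hev).hasLineDerivAt (EuclideanSpace.single i 1)
      convert! hfin using 1
      rw [Set.indicator_of_mem hx]
      simp [hD, pd, EuclideanSpace.inner_single_right]
      ring
    · rw [Set.indicator_of_notMem hx]
      have hx1 : 1 ≤ ‖x‖ := by simpa using hx
      have hO : (Metric.ball (0 : E m) 1).indicator f =O[𝓝 x] fun y => ‖y - x‖ ^ 2 := by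
        refine Asymptotics.IsBigO.of_bound (4 / ε ^ 2 * M) (Filter.Eventually.of_forall ?_)
        intro y
        by_cases hy : y ∈ Metric.ball (0 : E m) 1
        · rw [Set.indicator_of_mem hy]
          have hyB := hsub hy
          have hs0 := sfun_nonneg hyB
          have hy1 : ‖y‖ ≤ 1 := (mem_ball_iff y).1 hyB
          have hs2 : sfun y ≤ 2 * ‖y - x‖ := by
            have : ‖x‖ - ‖y‖ ≤ ‖y - x‖ := by
              rw [norm_sub_rev]; exact norm_sub_norm_le x y
            unfold sfun; nlinarith [norm_nonneg y]
          have h3 : (sfun y / (sfun y + ε)) ≤ 2 * ‖y - x‖ / ε := by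
            apply div_le_div₀ (by positivity) hs2 hε (by linarith)
          have h4 : (sfun y / (sfun y + ε)) ^ 2 ≤ (2 * ‖y - x‖ / ε) ^ 2 := by
            apply pow_le_pow_left₀ (by positivity) h3
          rw [hf]
          simp only [norm_mul, norm_pow, norm_norm]
          rw [← norm_pow, Real.norm_of_nonneg (by positivity : 0 ≤ (sfun y / (sfun y + ε)) ^ 2)]
          calc _ ≤ (2 * ‖y - x‖ / ε) ^ 2 * M := by
                apply mul_le_mul h4 (hM y hyB) (norm_nonneg _) (by positivity)
            _ = _ := by ring
        · rw [Set.indicator_of_notMem hy]; simp; positivity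
      have := (hO.hasFDerivAt (𝕜 := ℝ) one_lt_two).hasLineDerivAt (EuclideanSpace.single i 1)
      simpa using this
  have := integral_bilinear_hasLineDerivAt_right_eq_neg_left_of_integrable (μ := volume)
    (f := (Metric.ball (0 : E m) 1).indicator f) (f' := (Metric.ball (0 : E m) 1).indicator D)
    (g := fun _ => (1 : ℝ)) (g' := fun _ => 0) (v := EuclideanSpace.single i 1)
    (B := ContinuousLinearMap.mul ℝ ℝ) (by simpa using hDi') (by simp) (by simpa using hfi')
    (fun x _ => hline x) (fun x _ => by
      simpa using (hasFDerivAt_const (1:ℝ) x).hasLineDerivAt (EuclideanSpace.single i (1:ℝ)))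
  simpa using this

lemma div_lemma {m : ℕ} {X : Fin m → E m → ℝ} (hX : ∀ i, Sm (X i))
    (hb : ∀ x ∈ Sph m, ∑ k, x k * X k x = 0)
    (hpos : ∀ x ∈ Ball m, 0 ≤ ∑ i, pd i (X i) x) :
    ∀ x ∈ Ball m, ∑ i, pd i (X i) x = 0 := by
  have hcomp : IsCompact (Ball m) := isCompact_closedBall _ _
  have hsub : Metric.ball (0 : E m) 1 ⊆ Ball m := Metric.ball_subset_closedBall
  have hmeas : MeasurableSet (Metric.ball (0 : E m) 1) := Metric.isOpen_ball.measurableSet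
  set d : E m → ℝ := fun x => ∑ i, pd i (X i) x with hd
  set g : E m → ℝ := fun x => ∑ k, x k * X k x with hg
  have hds : Sm d := sm_sum fun i => (hX i).pd i
  have hgs : Sm g := sm_sum fun i => (sm_coord i).mul' (hX i)
  obtain ⟨M, hM⟩ := hcomp.exists_bound_of_continuousOn hds.continuousOn
  obtain ⟨K, hK⟩ := hcomp.exists_bound_of_continuousOn
    (hgs.continuousOn_fderivWithin (ball_ud m) (by simp))
  have hK0 : 0 ≤ K := (norm_nonneg _).trans (hK 0 (by simp [Ball]))
  have hM0 : 0 ≤ M := (norm_nonneg _).trans (hM 0 (by simp [Ball]))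
  have hgK : ∀ x ∈ Ball m, |g x| ≤ K * sfun x := by
    intro x hx
    by_cases h0 : x = 0
    · subst h0
      have : g 0 = 0 := by simp [hg]
      rw [this, abs_zero]; exact mul_nonneg hK0 (sfun_nonneg hx)
    · have hn : 0 < ‖x‖ := norm_pos_iff.2 h0
      have hx1 := (mem_ball_iff x).1 hx
      have hyn : ‖(‖x‖⁻¹ • x)‖ = 1 := by
        rw [norm_smul, norm_inv, norm_norm]; field_simp
      have hy : g (‖x‖⁻¹ • x) = 0 := hb _ (by simp [Sph, hyn])
      have := (ball_convex m).norm_image_sub_le_of_norm_fderivWithin_le hgs.diff hK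
        ((mem_ball_iff (‖x‖⁻¹ • x)).2 hyn.le) hx
      rw [hy, sub_zero] at this
      have h2 : ‖x - ‖x‖⁻¹ • x‖ = 1 - ‖x‖ := by
        have : x - ‖x‖⁻¹ • x = (1 - ‖x‖⁻¹) • x := by rw [sub_smul, one_smul]
        rw [this, norm_smul, Real.norm_eq_abs, abs_of_nonpos]
        · field_simp; ring
        · have := (one_le_inv₀ hn).2 hx1; linarith
      rw [h2] at this
      refine this.trans (mul_le_mul_of_nonneg_left ?_ hK0)
      unfold sfun; nlinarith
  let ε : ℕ → ℝ := fun n => 1 / ((n : ℝ) + 1)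
  have hε : ∀ n, 0 < ε n := fun n => by positivity
  have hε0 : Tendsto ε atTop (𝓝 0) := tendsto_one_div_add_atTop_nhds_zero_nat
  let G : ℕ → E m → ℝ := fun n x => (sfun x / (sfun x + ε n)) ^ 2 * d x
        - 4 * sfun x * ε n / (sfun x + ε n) ^ 3 * g x
  have hGeq : ∀ n x, G n x = ∑ i, ((sfun x / (sfun x + ε n)) ^ 2 * pd i (X i) x
        - 4 * sfun x * ε n / (sfun x + ε n) ^ 3 * (x i * X i x)) := by
    intro n x
    simp only [G, hd, hg, Finset.mul_sum, Finset.sum_sub_distrib]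
  have hGi : ∀ n, IntegrableOn (G n) (Metric.ball 0 1) volume := by
    intro n
    have : G n = fun x => ∑ i, ((sfun x / (sfun x + ε n)) ^ 2 * pd i (X i) x
        - 4 * sfun x * ε n / (sfun x + ε n) ^ 3 * (x i * X i x)) := funext (hGeq n)
    rw [this]
    exact integrable_finsetSum _ fun i _ => (int_cutoff (hX i) i (hε n)).1
  have hG0 : ∀ n, ∫ x in Metric.ball (0 : E m) 1, G n x = 0 := by
    intro n
    simp_rw [hGeq]
    rw [integral_finsetSum _ fun i _ => (int_cutoff (hX i) i (hε n)).1]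
    exact Finset.sum_eq_zero fun i _ => (int_cutoff (hX i) i (hε n)).2
  have hlim : Tendsto (fun n => ∫ x in Metric.ball (0 : E m) 1, G n x) atTop
      (𝓝 (∫ x in Metric.ball (0 : E m) 1, d x)) := by
    refine tendsto_integral_of_dominated_convergence (fun _ => M + 4 * K)
      (fun n => (hGi n).aestronglyMeasurable) ?_ ?_ ?_
    · exact integrableOn_const (by exact measure_ball_lt_top.ne) 
    · intro n
      refine (ae_restrict_iff' hmeas).2 (Filter.Eventually.of_forall fun x hx => ?_)
      have hxB := hsub hx
      have hs := sfun_nonneg hxB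
      have he := hε n
      have h1 : (sfun x / (sfun x + ε n)) ^ 2 ≤ 1 := by
        apply pow_le_one₀ (by positivity)
        rw [div_le_one (by positivity)]; linarith
      have h2 : |(sfun x / (sfun x + ε n)) ^ 2 * d x| ≤ M := by
        rw [abs_mul, abs_of_nonneg (by positivity)]
        have := hM x hxB
        rw [Real.norm_eq_abs] at this
        nlinarith [abs_nonneg (d x)]
      have h3 : |4 * sfun x * ε n / (sfun x + ε n) ^ 3 * g x| ≤ 4 * K := by
        rw [abs_mul, abs_of_nonneg (by positivity)]
        calc _ ≤ 4 * sfun x * ε n / (sfun x + ε n) ^ 3 * (K * sfun x) :=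
              mul_le_mul_of_nonneg_left (hgK x hxB) (by positivity)
          _ = 4 * K * (sfun x ^ 2 * ε n / (sfun x + ε n) ^ 3) := by ring
          _ ≤ 4 * K * 1 := by
              refine mul_le_mul_of_nonneg_left ?_ (by positivity)
              rw [div_le_one (by positivity)]
              have : (sfun x + ε n) ^ 3 - sfun x ^ 2 * ε n = sfun x ^ 3 + 2 * sfun x ^ 2 * ε n
                + 3 * sfun x * ε n ^ 2 + ε n ^ 3 := by ring
              have : 0 ≤ sfun x ^ 3 + 2 * sfun x ^ 2 * ε n
                + 3 * sfun x * ε n ^ 2 + ε n ^ 3 := by positivity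
              linarith
          _ = 4 * K := by ring
      rw [Real.norm_eq_abs]
      exact (abs_sub _ _).trans (add_le_add h2 h3)
    · refine (ae_restrict_iff' hmeas).2 (Filter.Eventually.of_forall fun x hx => ?_)
      have hs : 0 < sfun x := sfun_pos (by simpa using hx)
      have hc : ContinuousAt (fun e : ℝ => (sfun x / (sfun x + e)) ^ 2 * d x
        - 4 * sfun x * e / (sfun x + e) ^ 3 * g x) 0 := by
        have : sfun x + 0 ≠ 0 := by simpa using hs.ne'
        have h3 : (sfun x + 0) ^ 3 ≠ 0 := pow_ne_zero _ this
        fun_prop (disch := assumption)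
      have := hc.tendsto.comp hε0
      simpa [hs.ne', G, Function.comp_def] using this
  have hint : ∫ x in Metric.ball (0 : E m) 1, d x = 0 := by
    simp_rw [hG0] at hlim
    exact tendsto_nhds_unique hlim tendsto_const_nhds
  have hdi : IntegrableOn d (Metric.ball 0 1) volume :=
    (hds.continuousOn.integrableOn_compact hcomp).mono_set hsub
  have hae := (setIntegral_eq_zero_iff_of_nonneg_ae ((ae_restrict_iff' hmeas).2
    (Filter.Eventually.of_forall fun x hx => hpos x (hsub hx))) hdi).1 hint
  have heq := Measure.eqOn_open_of_ae_eq hae Metric.isOpen_ball (hds.continuousOn.mono hsub)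
    continuousOn_const
  exact heq.of_subset_closure hds.continuousOn continuousOn_const hsub (ball_closure m).ge

lemma harmonic_ball_zero {m : ℕ} (hm : 2 ≤ m) {g : E m → ℝ} (hg : Sm g)
    (hb : ∀ x ∈ Sph m, g x = 0) (hl : ∀ x ∈ Ball m, lap g x = 0) :
    ∀ x ∈ Ball m, g x = 0 := by
  have hdiv : ∀ x ∈ Ball m, ∑ i, pd i (fun y => g y * pd i g y) x = ∑ i, pd i g x ^ 2 := by
    intro x hx
    have : ∀ i, pd i (fun y => g y * pd i g y) x = pd i g x ^ 2 + g x * pd i (pd i g) x := by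
      intro i; rw [pd_mul hg (hg.pd i) i hx]; ring
    simp_rw [this]
    rw [Finset.sum_add_distrib, ← Finset.mul_sum]
    have := hl x hx
    unfold lap at this
    rw [this]; ring
  have h0 := div_lemma (X := fun i y => g y * pd i g y) (fun i => hg.mul' (hg.pd i))
    (fun x hx => by simp [hb x hx])
    (fun x hx => by rw [hdiv x hx]; exact Finset.sum_nonneg fun i _ => sq_nonneg _)
  have hz : ∀ i, ∀ x ∈ Ball m, pd i g x = 0 := by
    intro i x hx
    have := h0 x hx
    rw [hdiv x hx, Finset.sum_eq_zero_iff_of_nonneg (fun i _ => sq_nonneg _)] at this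
    simpa using this i (Finset.mem_univ i)
  intro x hx
  have hp : ‖(EuclideanSpace.single (⟨0, by omega⟩ : Fin m) (1:ℝ) : E m)‖ = 1 := by simp
  rw [const_of_pd_zero hg hz hx ((mem_ball_iff _).2 hp.le)]
  exact hb _ (by simp [Sph])

theorem svt_decomposition_on_ball_uniqueness
    (m : ℕ) (hm : 2 ≤ m)
    (u : E m → ℝ) (w : Fin m → E m → ℝ) (T : Fin m → Fin m → E m → ℝ)
    -- smoothness up to the boundary
    (hu : ContDiffOn ℝ (⊤ : ℕ∞) u (Ball m))
    (hw : ∀ i, ContDiffOn ℝ (⊤ : ℕ∞) (w i) (Ball m))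
    (hT : ∀ i j, ContDiffOn ℝ (⊤ : ℕ∞) (T i j) (Ball m))
    -- side conditions:
    (hu_bdry : ∀ x ∈ Sph m, u x = 0)
    (hw_div : ∀ x ∈ Ball m, ∑ i, pd i (w i) x = 0)
    (hw_tang : ∀ x ∈ Sph m, ∑ k, w k x * x k = 0)
    (hw_curl : ∀ x ∈ Sph m, ∀ v : E m, (∑ k, v k * x k) = 0 →
      ∑ k, ∑ l, (pd k (w l) x - pd l (w k) x) * x k * v l = 0)
    (hT_symm : ∀ x ∈ Ball m, ∀ i j, T i j x = T j i x)
    (hT_trace : ∀ x ∈ Ball m, ∑ i, T i i x = 0)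
    (hT_transv : ∀ x ∈ Ball m, ∀ j, ∑ i, pd i (T i j) x = 0)
    -- the sum of the three pieces vanishes on the ball:
    (hzero : ∀ x ∈ Ball m, ∀ i j,
      diam i j u x + (1/2) * (pd i (w j) x + pd j (w i) x) + T i j x = 0) :
    (∀ i, ∀ x ∈ Ball m, w i x = 0) ∧
    (∀ i j, ∀ x ∈ Ball m, T i j x = 0) ∧
    (∀ i j, ∀ x ∈ Ball m, diam i j u x = 0) := by
  replace hu : Sm u := hu
  replace hw : ∀ i, Sm (w i) := hw
  replace hT : ∀ i j, Sm (T i j) := hT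
  -- basic consequences of the divergence condition
  have hFs : ∀ i j, Sm (fun y => pd i (w j) y - pd j (w i) y) :=
    fun i j => ((hw j).pd i).sub' ((hw i).pd j)
  have hdivj : ∀ j, ∀ x ∈ Ball m, ∑ i, pd i (pd j (w i)) x = 0 := by
    intro j x hx
    have h1 : pd j (fun y => ∑ i, pd i (w i) y) x = 0 := by
      rw [pd_congr hw_div j hx, pd_const]
    rw [pd_sum (fun i => (hw i).pd i) j hx] at h1
    rw [← h1]
    exact Finset.sum_congr rfl fun i _ => pd_comm (hw i) i j hx
  have hlapj : ∀ j, ∀ x ∈ Ball m, ∑ i, pd i (pd i (pd j u)) x = pd j (lap u) x := by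
    intro j x hx
    have h1 : pd j (lap u) x = ∑ i, pd j (pd i (pd i u)) x :=
      pd_sum (fun i => (hu.pd i).pd i) j hx
    rw [h1]
    refine Finset.sum_congr rfl fun i _ => ?_
    rw [pd_comm (hu.pd i) j i hx]
    exact pd_congr (fun y hy => pd_comm hu i j hy) i hx
  set c : ℝ := 1 - 1 / (m : ℝ) with hc
  have hm0 : (0 : ℝ) < m := by exact_mod_cast (by omega : 0 < m)
  have hc0 : c ≠ 0 := by
    have : (2 : ℝ) ≤ m := by exact_mod_cast hm
    have h2 : 1 / (m : ℝ) ≤ 1 / 2 := one_div_le_one_div_of_le (by norm_num) this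
    rw [hc]; intro h; linarith
  -- divergence of the main equation
  have hmain : ∀ j, ∀ x ∈ Ball m, c * pd j (lap u) x + (1/2) * lap (w j) x = 0 := by
    intro j x hx
    have hi : ∀ i, pd i (pd i (pd j u)) x - (if i = j then (1 : ℝ) else 0) / m * pd i (lap u) x
        + (1/2) * (pd i (pd i (w j)) x + pd i (pd j (w i)) x) + pd i (T i j) x = 0 := by
      intro i
      have h1 : pd i (fun y => diam i j u y + (1/2) * (pd i (w j) y + pd j (w i) y) + T i j y) x
          = 0 := by
        rw [pd_congr (fun y hy => hzero y hy i j) i hx, pd_const]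
      have s1 : Sm (fun y => (if i = j then (1 : ℝ) else 0) / m * lap u y) := hu.lap.cmul _
      have s2 : Sm (diam i j u) := ((hu.pd j).pd i).sub' s1
      have s3 : Sm (fun y => pd i (w j) y + pd j (w i) y) := ((hw j).pd i).add' ((hw i).pd j)
      rw [pd_add (s2.add' (s3.cmul _)) (hT i j) i hx, pd_add s2 (s3.cmul _) i hx,
        pd_cmul _ s3 i hx, pd_add ((hw j).pd i) ((hw i).pd j) i hx] at h1
      have h2 : pd i (diam i j u) x = pd i (pd i (pd j u)) x
          - (if i = j then (1 : ℝ) else 0) / m * pd i (lap u) x := by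
        have : pd i (diam i j u) x = _ := pd_sub ((hu.pd j).pd i) s1 i hx
        rw [this, pd_cmul _ hu.lap i hx]
      rw [h2] at h1
      exact h1
    have hs := Finset.sum_eq_zero (s := Finset.univ) (fun i _ => hi i)
    rw [Finset.sum_add_distrib, Finset.sum_add_distrib, Finset.sum_sub_distrib, ← Finset.mul_sum,
      Finset.sum_add_distrib, hlapj j x hx, hdivj j x hx, hT_transv x hx j] at hs
    have h3 : ∑ i, (if i = j then (1 : ℝ) else 0) / m * pd i (lap u) x
        = 1 / m * pd j (lap u) x := by
      rw [Finset.sum_eq_single j]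
      · simp
      · intro b _ hb; simp [hb]
      · simp
    rw [h3] at hs
    have h4 : lap (w j) x = ∑ i, pd i (pd i (w j)) x := rfl
    rw [h4, hc]; linarith
  have hFdiv : ∀ j, ∀ x ∈ Ball m,
      ∑ i, pd i (fun y => pd i (w j) y - pd j (w i) y) x = lap (w j) x := by
    intro j x hx
    have : ∀ i, pd i (fun y => pd i (w j) y - pd j (w i) y) x
        = pd i (pd i (w j)) x - pd i (pd j (w i)) x :=
      fun i => pd_sub ((hw j).pd i) ((hw i).pd j) i hx
    simp_rw [this]
    rw [Finset.sum_sub_distrib, hdivj j x hx, sub_zero]; rfl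
  -- the energy identity
  let X : Fin m → E m → ℝ := fun i y => c * (lap u y * w i y)
    + (1/2) * ∑ j, (pd i (w j) y - pd j (w i) y) * w j y
  have hXs1 : ∀ i, Sm (fun y => ∑ j, (pd i (w j) y - pd j (w i) y) * w j y) :=
    fun i => sm_sum fun j => (hFs i j).mul' (hw j)
  have hXs : ∀ i, Sm (X i) := fun i =>
    ((hu.lap.mul' (hw i)).cmul c).add' ((hXs1 i).cmul _)
  have hXdiv : ∀ x ∈ Ball m, ∑ i, pd i (X i) x
      = (1/4) * ∑ i, ∑ j, (pd i (w j) x - pd j (w i) x) ^ 2 := by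
    intro x hx
    have h1 : ∀ i, pd i (X i) x = c * (pd i (lap u) x * w i x + lap u x * pd i (w i) x)
        + (1/2) * ∑ j, (pd i (fun y => pd i (w j) y - pd j (w i) y) x * w j x
          + (pd i (w j) x - pd j (w i) x) * pd i (w j) x) := by
      intro i
      have : pd i (X i) x = _ := pd_add ((hu.lap.mul' (hw i)).cmul c) ((hXs1 i).cmul _) i hx
      rw [this, pd_cmul _ (hu.lap.mul' (hw i)) i hx, pd_cmul _ (hXs1 i) i hx,
        pd_mul hu.lap (hw i) i hx, pd_sum (fun j => (hFs i j).mul' (hw j)) i hx]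
      congr 2
      exact Finset.sum_congr rfl fun j _ => pd_mul (hFs i j) (hw j) i hx
    simp_rw [h1, Finset.sum_add_distrib]
    rw [← Finset.mul_sum, ← Finset.mul_sum, Finset.sum_add_distrib, Finset.sum_add_distrib,
      ← Finset.mul_sum, hw_div x hx]
    rw [Finset.sum_comm (f := fun i j => pd i (fun y => pd i (w j) y - pd j (w i) y) x * w j x)]
    simp_rw [← Finset.sum_mul]
    have h2 : ∑ j, (∑ i, pd i (fun y => pd i (w j) y - pd j (w i) y) x) * w j x
        = ∑ j, (-(2 * c)) * (pd j (lap u) x * w j x) := by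
      refine Finset.sum_congr rfl fun j _ => ?_
      rw [hFdiv j x hx]
      have := hmain j x hx
      have h : lap (w j) x = -(2 * c) * pd j (lap u) x := by linarith
      rw [h]; ring
    have h3 : ∑ i, ∑ j, (pd i (w j) x - pd j (w i) x) ^ 2
        = 2 * ∑ i, ∑ j, (pd i (w j) x - pd j (w i) x) * pd i (w j) x := by
      have h4 : ∑ i, ∑ j, (pd i (w j) x - pd j (w i) x) * pd j (w i) x
          = - ∑ i, ∑ j, (pd i (w j) x - pd j (w i) x) * pd i (w j) x := by
        rw [Finset.sum_comm, ← Finset.sum_neg_distrib]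
        refine Finset.sum_congr rfl fun i _ => ?_
        rw [← Finset.sum_neg_distrib]
        exact Finset.sum_congr rfl fun j _ => by ring
      have h5 : ∑ i, ∑ j, (pd i (w j) x - pd j (w i) x) ^ 2
          = ∑ i, ∑ j, (pd i (w j) x - pd j (w i) x) * pd i (w j) x
          - ∑ i, ∑ j, (pd i (w j) x - pd j (w i) x) * pd j (w i) x := by
        rw [← Finset.sum_sub_distrib]
        refine Finset.sum_congr rfl fun i _ => ?_
        rw [← Finset.sum_sub_distrib]
        exact Finset.sum_congr rfl fun j _ => by ring
      rw [h5, h4]; ring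
    rw [h2, h3, ← Finset.mul_sum]; ring
  have hXb : ∀ x ∈ Sph m, ∑ k, x k * X k x = 0 := by
    intro x hx
    have h1 := hw_tang x hx
    have h2 := hw_curl x hx (WithLp.toLp 2 (fun k => w k x)) (by simpa using h1)
    have h3 : ∑ k, x k * X k x = c * lap u x * ∑ k, w k x * x k
        + (1/2) * ∑ k, ∑ l, (pd k (w l) x - pd l (w k) x) * x k * w l x := by
      rw [Finset.mul_sum, Finset.mul_sum, ← Finset.sum_add_distrib]
      refine Finset.sum_congr rfl fun k _ => ?_
      simp only [X]
      rw [mul_add]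
      congr 1
      · ring
      · rw [mul_left_comm, Finset.mul_sum]
        congr 1
        exact Finset.sum_congr rfl fun l _ => by ring
    rw [h3, h1]
    simp only at h2
    rw [h2]; ring
  have hX0 := div_lemma hXs hXb (fun x hx => by
    rw [hXdiv x hx]
    exact mul_nonneg (by norm_num) (Finset.sum_nonneg fun i _ =>
      Finset.sum_nonneg fun j _ => sq_nonneg _))
  have hF0 : ∀ x ∈ Ball m, ∀ i j, pd i (w j) x = pd j (w i) x := by
    intro x hx i j
    have h1 : ∑ i, ∑ j, (pd i (w j) x - pd j (w i) x) ^ 2 = 0 := by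
      have := hX0 x hx
      rw [hXdiv x hx] at this; linarith
    rw [Finset.sum_eq_zero_iff_of_nonneg
      (fun i _ => Finset.sum_nonneg fun j _ => sq_nonneg _)] at h1
    have h2 := h1 i (Finset.mem_univ i)
    rw [Finset.sum_eq_zero_iff_of_nonneg (fun i _ => sq_nonneg _)] at h2
    have h3 := h2 j (Finset.mem_univ j)
    have := pow_eq_zero_iff (two_ne_zero) |>.1 h3
    linarith
  have hlapw : ∀ j, ∀ x ∈ Ball m, lap (w j) x = 0 := by
    intro j x hx
    rw [← hFdiv j x hx]
    refine Finset.sum_eq_zero fun i _ => ?_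
    rw [pd_congr (g := fun _ => 0) (fun y hy => by rw [hF0 y hy i j]; ring) i hx, pd_const]
  -- the radial component of w is harmonic
  let g : E m → ℝ := fun y => ∑ k, y k * w k y
  have hgs : Sm g := sm_sum fun k => (sm_coord k).mul' (hw k)
  have hgpd : ∀ i, ∀ x ∈ Ball m, pd i g x = w i x + ∑ k, x k * pd i (w k) x := by
    intro i x hx
    have h1 : pd i g x = ∑ k, pd i (fun y => y k * w k y) x :=
      pd_sum (fun k => (sm_coord k).mul' (hw k)) i hx
    rw [h1]
    have h2 : ∀ k, pd i (fun y : E m => y k * w k y) x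
        = (if i = k then 1 else 0) * w k x + x k * pd i (w k) x := by
      intro k; rw [pd_mul (sm_coord k) (hw k) i hx, pd_coord k i hx]
    simp_rw [h2]
    rw [Finset.sum_add_distrib]
    simp
  have hglap : ∀ x ∈ Ball m, lap g x = 0 := by
    intro x hx
    have h1 : ∀ i, pd i (pd i g) x = 2 * pd i (w i) x + ∑ k, x k * pd i (pd i (w k)) x := by
      intro i
      have hs : ∀ k, Sm (fun y : E m => y k * pd i (w k) y) :=
        fun k => (sm_coord k).mul' ((hw k).pd i)
      rw [pd_congr (hgpd i) i hx, pd_add (hw i) (sm_sum hs) i hx, pd_sum hs i hx]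
      have h2 : ∀ k, pd i (fun y : E m => y k * pd i (w k) y) x
          = (if i = k then 1 else 0) * pd i (w k) x + x k * pd i (pd i (w k)) x := by
        intro k; rw [pd_mul (sm_coord k) ((hw k).pd i) i hx, pd_coord k i hx]
      simp_rw [h2]
      rw [Finset.sum_add_distrib]
      simp; ring
    have h3 : lap g x = ∑ i, pd i (pd i g) x := rfl
    rw [h3]
    simp_rw [h1]
    rw [Finset.sum_add_distrib, ← Finset.mul_sum, hw_div x hx, Finset.sum_comm]
    simp_rw [← Finset.mul_sum]
    rw [mul_zero, zero_add]
    refine Finset.sum_eq_zero fun k _ => ?_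
    have h4 : ∑ i, pd i (pd i (w k)) x = 0 := hlapw k x hx
    rw [h4, mul_zero]
  have hg0 : ∀ x ∈ Ball m, g x = 0 := harmonic_ball_zero hm hgs (fun x hx => by
    rw [← hw_tang x hx]
    exact Finset.sum_congr rfl fun k _ => mul_comm _ _) hglap
  have hrad : ∀ i, ∀ x ∈ Ball m, w i x + ∑ k, x k * pd k (w i) x = 0 := by
    intro i x hx
    have h1 := hgpd i x hx
    rw [pd_congr (g := fun _ => 0) hg0 i hx, pd_const] at h1
    rw [h1]
    congr 1
    exact Finset.sum_congr rfl fun k _ => by rw [hF0 x hx i k]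
  have hw0 : ∀ i, ∀ x ∈ Ball m, w i x = 0 := by
    intro i x hx
    have hxn := (mem_ball_iff x).1 hx
    have hmem : ∀ t ∈ Set.Icc (0:ℝ) 1, t • x ∈ Ball m := by
      intro t ht
      rw [mem_ball_iff, norm_smul, Real.norm_of_nonneg ht.1]
      exact mul_le_one₀ ht.2 (norm_nonneg _) hxn
    have hder : ∀ t ∈ Set.Icc (0:ℝ) 1,
        HasDerivWithinAt (fun t : ℝ => t * w i (t • x)) 0 (Set.Icc 0 1) t := by
      intro t ht
      have h1 : HasFDerivWithinAt (w i) (fderivWithin ℝ (w i) (Ball m) (t • x)) (Ball m) (t • x) :=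
        ((hw i).diff _ (hmem t ht)).hasFDerivWithinAt
      have h2 : HasDerivWithinAt (fun t : ℝ => t • x) ((1:ℝ) • x) (Set.Icc 0 1) t :=
        (hasDerivWithinAt_id t _).smul_const x
      have h3 := h1.comp_hasDerivWithinAt t h2 (fun t ht => hmem t ht)
      have h4 := (hasDerivWithinAt_id t (Set.Icc (0:ℝ) 1)).mul h3
      convert! h4 using 1
      have h5 := hrad i _ (hmem t ht)
      rw [one_smul, fderivWithin_eq_sum]
      simp only [PiLp.smul_apply, smul_eq_mul, mul_assoc] at h5
      rw [← Finset.mul_sum] at h5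
      simpa using h5.symm
    have := constant_of_derivWithin_zero (f := fun t : ℝ => t * w i (t • x)) (a := 0) (b := 1)
      (fun t ht => (hder t ht).differentiableWithinAt)
      (fun t ht => (hder t (Set.Ico_subset_Icc_self ht)).derivWithin
        (uniqueDiffOn_Icc zero_lt_one t (Set.Ico_subset_Icc_self ht)))
      1 (by simp)
    simpa using this
  have hpdw : ∀ i j, ∀ x ∈ Ball m, pd i (w j) x = 0 := by
    intro i j x hx
    rw [pd_congr (g := fun _ => 0) (hw0 j) i hx, pd_const]
  -- the Laplacian of u is constant
  have hlapc : ∀ j, ∀ x ∈ Ball m, pd j (lap u) x = 0 := by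
    intro j x hx
    have h1 := hmain j x hx
    rw [hlapw j x hx, mul_zero, add_zero] at h1
    exact (mul_eq_zero.1 h1).resolve_left hc0
  have h0B : (0 : E m) ∈ Ball m := by simp [Ball]
  set a : ℝ := lap u 0 with ha
  have hlapu : ∀ x ∈ Ball m, lap u x = a := fun x hx => const_of_pd_zero hu.lap hlapc hx h0B
  let q : E m → ℝ := fun y => (∑ k, y k * y k) - 1
  have hqs1 : Sm (fun y : E m => ∑ k, y k * y k) :=
    sm_sum fun k => (sm_coord k).mul' (sm_coord k)
  have hqs : Sm q := hqs1.sub' (sm_const 1)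
  have hqpd : ∀ j, ∀ x ∈ Ball m, pd j q x = 2 * x j := by
    intro j x hx
    have h1 : pd j q x = _ := pd_sub hqs1 (sm_const 1) j hx
    rw [h1, pd_const, pd_sum (fun k => (sm_coord k).mul' (sm_coord k)) j hx]
    have h2 : ∀ k, pd j (fun y : E m => y k * y k) x
        = (if j = k then 1 else 0) * x k + x k * (if j = k then 1 else 0) := by
      intro k; rw [pd_mul (sm_coord k) (sm_coord k) j hx, pd_coord k j hx]
    simp_rw [h2]
    rw [Finset.sum_add_distrib]
    simp; ring
  let v : E m → ℝ := fun y => u y - a / (2 * m) * q y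
  have hvs : Sm v := hu.sub' (hqs.cmul _)
  have hv2 : ∀ i j, ∀ x ∈ Ball m, pd i (pd j v) x = diam i j u x := by
    intro i j x hx
    have h1 : ∀ y ∈ Ball m, pd j v y = pd j u y - a / m * y j := by
      intro y hy
      have h2 : pd j v y = _ := pd_sub hu (hqs.cmul _) j hy
      rw [h2, pd_cmul _ hqs j hy, hqpd j y hy]
      field_simp
    rw [pd_congr h1 i hx, pd_sub (hu.pd j) ((sm_coord j).cmul _) i hx,
      pd_cmul _ (sm_coord j) i hx, pd_coord j i hx]
    unfold diam
    rw [hlapu x hx]; ring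
  have hvlap : ∀ x ∈ Ball m, lap v x = 0 := by
    intro x hx
    have h1 : lap v x = ∑ i, pd i (pd i v) x := rfl
    rw [h1]
    simp_rw [hv2 _ _ x hx]
    unfold diam
    rw [Finset.sum_sub_distrib]
    have h2 : ∑ i, pd i (pd i u) x = lap u x := rfl
    rw [h2]
    simp
    field_simp
    ring
  have hv0 : ∀ x ∈ Ball m, v x = 0 := harmonic_ball_zero hm hvs (fun x hx => by
    have h1 : ‖x‖ = 1 := by simpa [Sph] using hx
    have h2 : ∑ k, x k * x k = 1 := by
      have := EuclideanSpace.real_norm_sq_eq x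
      rw [h1] at this
      simp_rw [← sq]; linarith
    simp only [v, q]
    rw [hu_bdry x hx, h2]; ring) hvlap
  have hdiam : ∀ i j, ∀ x ∈ Ball m, diam i j u x = 0 := by
    intro i j x hx
    have h1 : ∀ y ∈ Ball m, pd j v y = 0 := by
      intro y hy
      rw [pd_congr (g := fun _ => 0) hv0 j hy, pd_const]
    rw [← hv2 i j x hx, pd_congr (g := fun _ => 0) h1 i hx, pd_const]
  refine ⟨hw0, ?_, hdiam⟩
  intro i j x hx
  have h1 := hzero x hx i j
  rw [hdiam i j x hx, hpdw i j x hx, hpdw j i x hx] at h1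
  linarith


end
end
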